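/- The set of pairs (f_0, f_1) realized by 6-polytopes of excess degree strictly larger than 8 is exactly {(f0, f1) : 3·f0 + 4 < f1 ≤ f0·(f0−1)/2}. -/

import Mathlib

open Set

/-- A polytope: the convex hull of a finite set of points. -/
def IsPolytope {n : ℕ} (P : Set (Fin n → ℝ)) : Prop :=
  ∃ S : Finset (Fin n → ℝ), P = convexHull ℝ (S : Set (Fin n → ℝ))

/-- The affine dimension of a set: the rank of its vector span. -/
noncomputable def adim {n : ℕ} (P : Set (Fin n → ℝ)) : ℕ :=
  Module.finrank ℝ (vectorSpan ℝ P)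

/-- A `d`-polytope: a polytope whose affine hull has dimension `d`. -/
def IsDPolytope (d : ℕ) {n : ℕ} (P : Set (Fin n → ℝ)) : Prop :=
  IsPolytope P ∧ adim P = d

/-- An edge of `P`: a face (an extreme convex subset) of affine dimension 1. -/
def IsEdge {n : ℕ} (P E : Set (Fin n → ℝ)) : Prop :=
  IsExtreme ℝ P E ∧ Convex ℝ E ∧ adim E = 1

/-- `f₀ P`: the number of vertices (extreme points) of `P`. -/
noncomputable def f₀ {n : ℕ} (P : Set (Fin n → ℝ)) : ℕ :=
  (Set.extremePoints ℝ P).ncard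

/-- `f₁ P`: the number of edges of `P`. -/
noncomputable def f₁ {n : ℕ} (P : Set (Fin n → ℝ)) : ℕ :=
  {E : Set (Fin n → ℝ) | IsEdge P E}.ncard

/-- `E^d`: the set of `(f₀, f₁)` pairs realized by `d`-polytopes. -/
def fPairs (d : ℕ) : Set (ℕ × ℕ) :=
  {p | ∃ (n : ℕ) (P : Set (Fin n → ℝ)), IsDPolytope d P ∧ f₀ P = p.1 ∧ f₁ P = p.2}

section Convexity

/-- The linear functional `f` vanishes on `A` and is negative on the rest of `V`. -/
def ExposedBy {E : Type*} [AddCommGroup E] [Module ℝ E] (V A : Finset E) (f : E →ₗ[ℝ] ℝ) : Prop :=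
  (∀ a ∈ A, f a = 0) ∧ ∀ w ∈ V, w ∉ A → f w < 0

/-- Some linear functional exposes `A` inside `V`. When `V` lies on an affine hyperplane missing
the origin, this says that `A` spans a face of the convex hull of `V`. -/
def IsFace {E : Type*} [AddCommGroup E] [Module ℝ E] (V A : Finset E) : Prop :=
  ∃ f : E →ₗ[ℝ] ℝ, ExposedBy V A f

open Classical in
/-- The pairs of points of `V` that span a face. -/
noncomputable def edgeSet {E : Type*} [AddCommGroup E] [Module ℝ E] (V : Finset E) :
    Finset (Finset E) :=
  (V.powersetCard 2).filter (IsFace V)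

variable {E : Type*} [AddCommGroup E] [Module ℝ E] {V A : Finset E}

theorem mem_edgeSet : A ∈ edgeSet V ↔ A ⊆ V ∧ A.card = 2 ∧ IsFace V A := by
  simp [edgeSet, Finset.mem_powersetCard, and_assoc]

theorem IsExtreme.eq_convexHull_inter {F : Set E}
    (h : IsExtreme ℝ (convexHull ℝ (V : Set E)) F) (hc : Convex ℝ F) :
    F = convexHull ℝ ((V : Set E) ∩ F) := by
  classical
  refine Subset.antisymm (fun x hx => ?_) (convexHull_min inter_subset_right hc)
  obtain ⟨w, hw0, hw1, rfl⟩ := Finset.mem_convexHull'.1 (h.subset hx)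
  have key : ∀ v ∈ V, w v ≠ 0 → v ∈ F := by
    intro v hv hv0
    have hpos : 0 < w v := lt_of_le_of_ne (hw0 v hv) (Ne.symm hv0)
    have hsum := Finset.add_sum_erase V w hv
    have hsum' := Finset.add_sum_erase V (fun y => w y • y) hv
    have hnn : 0 ≤ ∑ u ∈ V.erase v, w u :=
      Finset.sum_nonneg fun u hu => hw0 u (Finset.mem_of_mem_erase hu)
    rcases hnn.eq_or_lt with h0 | h0
    · have hz : ∀ u ∈ V.erase v, w u = 0 :=
        (Finset.sum_eq_zero_iff_of_nonneg fun u hu => hw0 u (Finset.mem_of_mem_erase hu)).1 h0.symm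
      have : ∑ u ∈ V.erase v, w u • u = 0 :=
        Finset.sum_eq_zero fun u hu => by rw [hz u hu, zero_smul]
      have h1 : w v = 1 := by linarith
      rw [← hsum', this, h1] at hx
      simpa using hx
    · have hy : (V.erase v).centerMass w id ∈ convexHull ℝ (V : Set E) :=
        Finset.centerMass_mem_convexHull _ (fun u hu => hw0 u (Finset.mem_of_mem_erase hu)) h0
          fun u hu => Finset.mem_of_mem_erase hu
      refine h.left_mem_of_mem_openSegment (subset_convexHull ℝ _ hv) hy hx
        ⟨w v, ∑ u ∈ V.erase v, w u, hpos, h0, by linarith, ?_⟩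
      rw [← hsum', Finset.centerMass, smul_smul, mul_inv_cancel₀ h0.ne', one_smul]
      rfl
  rw [← Finset.sum_filter_of_ne (p := fun v => v ∈ F)
    fun v hv hne => key v hv fun h0 => hne (by rw [h0, zero_smul])]
  refine (convex_convexHull ℝ _).sum_mem (fun i hi => hw0 i (Finset.mem_filter.1 hi).1) ?_
    fun i hi => subset_convexHull ℝ _ (by simpa using hi)
  rw [Finset.sum_filter_of_ne, hw1]
  exact fun v hv hne => key v hv hne

theorem ExposedBy.isExtreme {f : E →ₗ[ℝ] ℝ} (hf : ExposedBy V A f) (hA : A ⊆ V) :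
    IsExtreme ℝ (convexHull ℝ (V : Set E)) (convexHull ℝ (A : Set E)) := by
  classical
  have hle : ∀ v ∈ V, f v ≤ 0 := fun v hv => by
    by_cases h : v ∈ A
    · exact (hf.1 v h).le
    · exact (hf.2 v hv h).le
  have hleV : ∀ x ∈ convexHull ℝ (V : Set E), f x ≤ 0 := fun x hx =>
    (convexHull_min (fun v hv => hle v hv) (convex_halfSpace_le f.isLinear 0) :
      convexHull ℝ (V : Set E) ⊆ {x | f x ≤ 0}) hx
  have heqA : ∀ x ∈ convexHull ℝ (A : Set E), f x = 0 := fun x hx =>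
    (convexHull_min (fun v hv => hf.1 v hv) (convex_hyperplane f.isLinear 0) :
      convexHull ℝ (A : Set E) ⊆ {x | f x = 0}) hx
  have hmem : ∀ x ∈ convexHull ℝ (V : Set E), f x = 0 → x ∈ convexHull ℝ (A : Set E) := by
    intro x hx hx0
    obtain ⟨w, hw0, hw1, rfl⟩ := Finset.mem_convexHull'.1 hx
    simp only [map_sum, map_smul, smul_eq_mul] at hx0
    have hz := (Finset.sum_eq_zero_iff_of_nonpos fun v hv =>
      mul_nonpos_of_nonneg_of_nonpos (hw0 v hv) (hle v hv)).1 hx0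
    have hout : ∀ v ∈ V, v ∉ A → w v = 0 := fun v hv hvA =>
      (mul_eq_zero.1 (hz v hv)).resolve_right (hf.2 v hv hvA).ne
    rw [← Finset.sum_subset hA fun v hv hvA => by rw [hout v hv hvA, zero_smul]]
    refine (convex_convexHull ℝ _).sum_mem (fun i hi => hw0 i (hA hi)) ?_
      fun i hi => subset_convexHull ℝ _ hi
    rw [Finset.sum_subset hA fun v hv hvA => hout v hv hvA, hw1]
  refine ⟨convexHull_mono (Finset.coe_subset.2 hA), ?_⟩
  rintro x hx y hy z hz ⟨a, b, ha, hb, -, rfl⟩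
  refine hmem x hx ?_
  have h1 := heqA _ hz
  simp only [map_add, map_smul, smul_eq_mul] at h1
  nlinarith [hleV x hx, hleV y hy, mul_nonneg ha.le (neg_nonneg.2 (hleV x hx)),
    mul_nonneg hb.le (neg_nonneg.2 (hleV y hy)), mul_pos ha hb]

end Convexity

section Edges

variable {n : ℕ} {V : Finset (Fin n → ℝ)}

theorem eq_of_wbtw_of_mem_extremePoints {K : Set (Fin n → ℝ)} {x y z : Fin n → ℝ}
    (h : Wbtw ℝ x y z) (hx : x ∈ K) (hz : z ∈ K) (hy : y ∈ K.extremePoints ℝ) : y = x ∨ y = z := by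
  have h' : y ∈ segment ℝ x z := by rwa [mem_segment_iff_wbtw]
  rcases (mem_extremePoints_iff_forall_segment.1 hy).2 x hx z hz h' with h | h
  · exact Or.inl h.symm
  · exact Or.inr h.symm

theorem IsEdge.eq_segment (hV : ∀ v ∈ V, v ∈ (convexHull ℝ (V : Set (Fin n → ℝ))).extremePoints ℝ)
    {F : Set (Fin n → ℝ)} (h : IsEdge (convexHull ℝ (V : Set (Fin n → ℝ))) F) :
    ∃ u ∈ V, ∃ v ∈ V, u ≠ v ∧ F = segment ℝ u v ∧ ∀ w ∈ V, w ∈ F → w = u ∨ w = v := by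
  obtain ⟨hext, hconv, hdim⟩ := h
  have hF := hext.eq_convexHull_inter hconv
  have hnt : ((V : Set (Fin n → ℝ)) ∩ F).Nontrivial := by
    by_contra hs
    rw [not_nontrivial_iff] at hs
    rw [hF, adim, ← direction_affineSpan, affineSpan_convexHull, direction_affineSpan,
      vectorSpan_of_subsingleton ℝ hs] at hdim
    simp at hdim
  obtain ⟨u, ⟨huV, huF⟩, v, ⟨hvV, hvF⟩, huv⟩ := hnt
  have hcol : Collinear ℝ F := by
    rw [collinear_iff_finrank_le_one]
    exact hdim.le
  have hthird : ∀ w ∈ V, w ∈ F → w = u ∨ w = v := by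
    intro w hw hwF
    have hc : Collinear ℝ {u, v, w} := hcol.subset (by
      rintro x (rfl | rfl | rfl) <;> assumption)
    have hm : ∀ x ∈ V, x ∈ convexHull ℝ (V : Set (Fin n → ℝ)) := fun x hx =>
      subset_convexHull ℝ _ hx
    rcases hc.wbtw_or_wbtw_or_wbtw with h | h | h
    · rcases eq_of_wbtw_of_mem_extremePoints h (hm u huV) (hm w hw) (hV v hvV) with h | h
      · exact absurd h.symm huv
      · exact Or.inr h.symm
    · exact (eq_of_wbtw_of_mem_extremePoints h (hm v hvV) (hm u huV) (hV w hw)).symm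
    · rcases eq_of_wbtw_of_mem_extremePoints h (hm w hw) (hm v hvV) (hV u huV) with h | h
      · exact Or.inl h.symm
      · exact absurd h huv
  refine ⟨u, huV, v, hvV, huv, ?_, hthird⟩
  have : (V : Set (Fin n → ℝ)) ∩ F = {u, v} := by
    ext w
    constructor
    · rintro ⟨hw, hwF⟩
      exact hthird w hw hwF
    · rintro (rfl | rfl)
      · exact ⟨huV, huF⟩
      · exact ⟨hvV, hvF⟩
  rw [hF, this, convexHull_pair]

theorem IsEdge.isFace (φ : (Fin n → ℝ) →ₗ[ℝ] ℝ) (hφ : ∀ v ∈ V, φ v = 1)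
    (hV : ∀ v ∈ V, v ∈ (convexHull ℝ (V : Set (Fin n → ℝ))).extremePoints ℝ)
    {F : Set (Fin n → ℝ)} (h : IsEdge (convexHull ℝ (V : Set (Fin n → ℝ))) F) :
    ∃ A ∈ edgeSet V, F = convexHull ℝ (A : Set (Fin n → ℝ)) := by
  classical
  obtain ⟨u, hu, v, hv, huv, rfl, hF⟩ := h.eq_segment hV
  refine ⟨{u, v}, mem_edgeSet.2 ⟨?_, Finset.card_pair huv, ?_⟩, by simp [convexHull_pair]⟩
  · intro x hx
    rcases Finset.mem_insert.1 hx with rfl | hx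
    · exact hu
    · rwa [Finset.mem_singleton.1 hx]
  have hm : ∀ x ∈ V, x ∈ convexHull ℝ (V : Set (Fin n → ℝ)) := fun x hx =>
    subset_convexHull ℝ _ hx
  have hsub : convexHull ℝ ((V \ {u, v} : Finset (Fin n → ℝ)) : Set (Fin n → ℝ)) ⊆
      convexHull ℝ (V : Set (Fin n → ℝ)) :=
    convexHull_mono (Finset.coe_subset.2 Finset.sdiff_subset)
  have hdisj : Disjoint
      (convexHull ℝ ((V \ {u, v} : Finset (Fin n → ℝ)) : Set (Fin n → ℝ)))
      (line[ℝ, u, v] : Set (Fin n → ℝ)) := by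
    rw [Set.disjoint_left]
    intro x hx hxl
    have hxV := hsub hx
    have hxF : x ∈ segment ℝ u v := by
      have hc : Collinear ℝ {x, u, v} := (collinear_insert_iff_of_mem_affineSpan hxl).2
        (collinear_pair ℝ u v)
      rcases hc.wbtw_or_wbtw_or_wbtw with h | h | h
      · rcases eq_of_wbtw_of_mem_extremePoints h hxV (hm v hv) (hV u hu) with h | h
        · rw [← h]; exact left_mem_segment ℝ u v
        · exact absurd h huv
      · rcases eq_of_wbtw_of_mem_extremePoints h (hm u hu) hxV (hV v hv) with h | h
        · exact absurd h.symm huv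
        · rw [← h]; exact right_mem_segment ℝ u v
      · rw [mem_segment_iff_wbtw]; exact wbtw_comm.1 h
    have hext : IsExtreme ℝ
        (convexHull ℝ ((V \ {u, v} : Finset (Fin n → ℝ)) : Set (Fin n → ℝ)))
        (convexHull ℝ ((V \ {u, v} : Finset (Fin n → ℝ)) : Set (Fin n → ℝ)) ∩ segment ℝ u v) :=
      ⟨inter_subset_left, fun a ha b hb z hz hz' =>
        ⟨ha, h.1.left_mem_of_mem_openSegment (hsub ha) (hsub hb) hz.2 hz'⟩⟩
    have hE := hext.eq_convexHull_inter ((convex_convexHull ℝ _).inter (convex_segment u v))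
    have hemp : ((V \ {u, v} : Finset (Fin n → ℝ)) : Set (Fin n → ℝ)) ∩
        (convexHull ℝ ((V \ {u, v} : Finset (Fin n → ℝ)) : Set (Fin n → ℝ)) ∩ segment ℝ u v) =
        ∅ := by
      ext w
      simp only [mem_inter_iff, Finset.mem_coe, Finset.mem_sdiff, Finset.mem_insert,
        Finset.mem_singleton, mem_empty_iff_false, iff_false]
      rintro ⟨⟨hw, hne⟩, -, hwF⟩
      exact hne (hF w hw hwF)
    rw [hemp, convexHull_empty] at hE
    have hx' : x ∈ convexHull ℝ ((V \ {u, v} : Finset (Fin n → ℝ)) : Set (Fin n → ℝ)) ∩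
        segment ℝ u v := ⟨hx, hxF⟩
    rwa [hE] at hx'
  obtain ⟨f, c₁, c₂, h1, h12, h2⟩ := geometric_hahn_banach_compact_closed
    (convex_convexHull ℝ _) ((V \ {u, v}).finite_toSet.isCompact_convexHull ℝ)
    (AffineSubspace.convex line[ℝ, u, v]) (AffineSubspace.closed_of_finiteDimensional _) hdisj
  have hline : ∀ t : ℝ, c₂ < f u + t * (f v - f u) := fun t => by
    have := h2 _ (AffineMap.lineMap_mem_affineSpan_pair t u v)
    rw [AffineMap.lineMap_apply] at this
    simpa [add_comm] using this
  have hfuv : f v = f u := by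
    by_contra hne
    have hne' : f v - f u ≠ 0 := sub_ne_zero.2 hne
    have := hline ((c₂ - f u) / (f v - f u))
    rw [div_mul_cancel₀ _ hne'] at this
    linarith
  refine ⟨f.toLinearMap - f u • φ, ?_, ?_⟩
  · intro a ha
    rcases Finset.mem_insert.1 ha with rfl | ha
    · simp [hφ _ hu]
    · rw [Finset.mem_singleton.1 ha]; simp [hφ _ hv, hfuv]
  · intro w hw hwA
    have := h1 w (subset_convexHull ℝ _ (by simpa using ⟨hw, by simpa using hwA⟩))
    have h3 := hline 0
    simp [hφ _ hw]
    linarith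

theorem isEdge_of_mem_edgeSet {A : Finset (Fin n → ℝ)} (hA : A ∈ edgeSet V) :
    IsEdge (convexHull ℝ (V : Set (Fin n → ℝ))) (convexHull ℝ (A : Set (Fin n → ℝ))) := by
  classical
  obtain ⟨hAV, hcard, f, hf⟩ := mem_edgeSet.1 hA
  refine ⟨hf.isExtreme hAV, convex_convexHull ℝ _, ?_⟩
  obtain ⟨u, v, huv, rfl⟩ := Finset.card_eq_two.1 hcard
  rw [adim, ← direction_affineSpan, affineSpan_convexHull, direction_affineSpan]
  have := (affineIndependent_of_ne ℝ huv).finrank_vectorSpan (n := 1) (by simp)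
  rwa [Matrix.range_cons, Matrix.range_cons, Matrix.range_empty, union_empty,
    singleton_union, ← Finset.coe_pair] at this

theorem extremePoints_convexHull_eq (hV : ∀ v ∈ V, IsFace V {v}) :
    (convexHull ℝ (V : Set (Fin n → ℝ))).extremePoints ℝ = V := by
  refine Subset.antisymm extremePoints_convexHull_subset fun v hv => ?_
  obtain ⟨f, hf⟩ := hV v hv
  have := hf.isExtreme (Finset.singleton_subset_iff.2 hv)
  rwa [Finset.coe_singleton, convexHull_singleton, isExtreme_singleton] at this

theorem f₀_convexHull (hV : ∀ v ∈ V, IsFace V {v}) :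
    f₀ (convexHull ℝ (V : Set (Fin n → ℝ))) = V.card := by
  rw [f₀, extremePoints_convexHull_eq hV, ncard_coe_finset]

theorem f₁_convexHull (φ : (Fin n → ℝ) →ₗ[ℝ] ℝ) (hφ : ∀ v ∈ V, φ v = 1)
    (hV : ∀ v ∈ V, IsFace V {v}) :
    f₁ (convexHull ℝ (V : Set (Fin n → ℝ))) = (edgeSet V).card := by
  have hext := extremePoints_convexHull_eq hV
  have himage : {F | IsEdge (convexHull ℝ (V : Set (Fin n → ℝ))) F} =
      (fun A : Finset (Fin n → ℝ) => convexHull ℝ (A : Set (Fin n → ℝ))) '' (edgeSet V) := by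
    ext F
    constructor
    · intro hF
      obtain ⟨A, hA, rfl⟩ := hF.isFace φ hφ fun v hv => by rw [hext]; exact hv
      exact ⟨A, hA, rfl⟩
    · rintro ⟨A, hA, rfl⟩
      exact isEdge_of_mem_edgeSet hA
  rw [f₁, himage, InjOn.ncard_image, ncard_coe_finset]
  have hrec : ∀ A ∈ edgeSet V, ∀ x, x ∈ A ↔ x ∈ V ∧ x ∈ convexHull ℝ (A : Set (Fin n → ℝ)) := by
    intro A hA x
    obtain ⟨hAV, -, f, hf⟩ := mem_edgeSet.1 hA
    refine ⟨fun hx => ⟨hAV hx, subset_convexHull ℝ _ hx⟩, fun ⟨hx, hxA⟩ => ?_⟩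
    have h0 : f x = 0 := (convexHull_min (fun v hv => hf.1 v hv)
      (convex_hyperplane f.isLinear 0) : convexHull ℝ (A : Set (Fin n → ℝ)) ⊆ {x | f x = 0}) hxA
    by_contra hne
    exact (hf.2 x hx hne).ne h0
  intro A hA B hB hAB
  ext x
  rw [hrec A hA, hrec B hB]
  simp only at hAB
  rw [hAB]

theorem adim_convexHull (φ : (Fin n → ℝ) →ₗ[ℝ] ℝ) (hφ : ∀ v ∈ V, φ v = 1)
    (hspan : Submodule.span ℝ (V : Set (Fin n → ℝ)) = ⊤) (hne : V.Nonempty) :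
    adim (convexHull ℝ (V : Set (Fin n → ℝ))) + 1 = n := by
  rw [adim, ← direction_affineSpan, affineSpan_convexHull, direction_affineSpan]
  obtain ⟨v₀, hv₀⟩ := hne
  have hker : vectorSpan ℝ (V : Set (Fin n → ℝ)) ≤ LinearMap.ker φ := by
    rw [vectorSpan_def, Submodule.span_le]
    rintro x ⟨a, ha, b, hb, rfl⟩
    simp [hφ a ha, hφ b hb]
  have hsup : vectorSpan ℝ (V : Set (Fin n → ℝ)) ⊔ Submodule.span ℝ {v₀} = ⊤ := by
    rw [eq_top_iff, ← hspan, Submodule.span_le]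
    intro v hv
    have : v = (v -ᵥ v₀) + v₀ := by simp
    rw [this]
    exact Submodule.add_mem_sup (vsub_mem_vectorSpan ℝ hv hv₀) (Submodule.mem_span_singleton_self _)
  have hinf : vectorSpan ℝ (V : Set (Fin n → ℝ)) ⊓ Submodule.span ℝ {v₀} = ⊥ := by
    rw [eq_bot_iff]
    rintro x ⟨hx, hx'⟩
    obtain ⟨c, rfl⟩ := Submodule.mem_span_singleton.1 hx'
    have := hker hx
    simp [hφ v₀ hv₀] at this
    simp [this]
  have hv0 : v₀ ≠ 0 := by
    rintro rfl
    simpa using hφ 0 hv₀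
  have := Submodule.finrank_sup_add_finrank_inf_eq (vectorSpan ℝ (V : Set (Fin n → ℝ)))
    (Submodule.span ℝ {v₀})
  rw [hsup, hinf, finrank_span_singleton hv0] at this
  simpa using this.symm

theorem two_mul_f₁_le {P : Set (Fin n → ℝ)} (hP : IsPolytope P) :
    2 * f₁ P ≤ f₀ P * (f₀ P - 1) := by
  obtain ⟨S, rfl⟩ := hP
  set P := convexHull ℝ (S : Set (Fin n → ℝ)) with hPdef
  have hfin : (P.extremePoints ℝ).Finite :=
    S.finite_toSet.subset extremePoints_convexHull_subset
  have hcompact : IsCompact P := S.finite_toSet.isCompact_convexHull ℝ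
  have hKM := closure_convexHull_extremePoints hcompact (convex_convexHull ℝ _)
  rw [(hfin.isClosed_convexHull ℝ).closure_eq] at hKM
  lift P.extremePoints ℝ to Finset (Fin n → ℝ) using hfin with V hVeq
  have hsub : {F | IsEdge P F} ⊆ (fun A : Finset (Fin n → ℝ) =>
      convexHull ℝ (A : Set (Fin n → ℝ))) '' (V.powersetCard 2) := by
    classical
    intro F hF
    rw [mem_ofPred_eq, ← hKM] at hF
    obtain ⟨u, hu, v, hv, huv, rfl, -⟩ := IsEdge.eq_segment (V := V)
      (fun v hv => by rw [hKM, ← hVeq]; exact hv) hF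
    refine ⟨{u, v}, ?_, by simp [convexHull_pair]⟩
    rw [Finset.mem_coe, Finset.mem_powersetCard]
    exact ⟨by simp [Finset.insert_subset_iff, hu, hv], Finset.card_pair huv⟩
  have hle : f₁ P ≤ V.card.choose 2 := by
    refine (ncard_le_ncard hsub ((Finset.finite_toSet _).image _)).trans ?_
    refine (ncard_image_le (Finset.finite_toSet _)).trans ?_
    rw [ncard_coe_finset, Finset.card_powersetCard]
  have hf0 : f₀ P = V.card := by rw [f₀, ← hVeq, ncard_coe_finset]
  rw [hf0]
  rw [Nat.choose_two_right] at hle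
  have := Nat.div_mul_le_self (V.card * (V.card - 1)) 2
  omega

end Edges

section Placing

open Filter Topology

variable {E : Type*} [AddCommGroup E] [Module ℝ E]

/-- A finite set of points in convex position on the hyperplane `φ = 1`, spanning the whole space,
with `n` points and `e` edges. -/
structure IsConfiguration (φ : E →ₗ[ℝ] ℝ) (V : Finset E) (n e : ℕ) : Prop where
  height : ∀ v ∈ V, φ v = 1
  vertex : ∀ v ∈ V, IsFace V {v}
  card_vertices : V.card = n
  card_edges : (edgeSet V).card = e
  span_eq_top : Submodule.span ℝ (V : Set E) = ⊤

/-- The centroid of `G`, displaced by `ε • u`. -/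
noncomputable def displacedCentroid (G : Finset E) (u : E) (ε : ℝ) : E :=
  (G.card : ℝ)⁻¹ • ∑ g ∈ G, g + ε • u

variable {φ f h : E →ₗ[ℝ] ℝ} {V A G N : Finset E} {u w y : E} {n e : ℕ}

theorem map_displacedCentroid (f : E →ₗ[ℝ] ℝ) (G : Finset E) (u : E) (ε : ℝ) :
    f (displacedCentroid G u ε) = (G.card : ℝ)⁻¹ * ∑ g ∈ G, f g + ε * f u := by
  simp [displacedCentroid, Finset.mul_sum]

theorem ExposedBy.nonpos (hf : ExposedBy V A f) {v : E} (hv : v ∈ V) : f v ≤ 0 := by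
  by_cases hA : v ∈ A
  · exact (hf.1 v hA).le
  · exact (hf.2 v hv hA).le

theorem IsFace.of_insert [DecidableEq E] (hF : IsFace (insert y V) A) : IsFace V A :=
  let ⟨f, hf⟩ := hF
  ⟨f, hf.1, fun w hw hA => hf.2 w (Finset.mem_insert_of_mem hw) hA⟩

theorem eventually_lt_of_lt {F : ℝ → ℝ} (hF : ContinuousAt F 0) {c : ℝ} (h0 : F 0 < c) :
    ∀ᶠ ε in 𝓝[>] (0 : ℝ), F ε < c :=
  (hF.tendsto.mono_left nhdsWithin_le_nhds).eventually_lt_const h0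

theorem ExposedBy.eventually_neg (hf : ExposedBy V A f) (hG : G ⊆ V) (hGA : ¬ G ⊆ A) (u : E) :
    ∀ᶠ ε in 𝓝[>] (0 : ℝ), f (displacedCentroid G u ε) < 0 := by
  obtain ⟨g₀, hg₀, hg₀A⟩ := Finset.not_subset.1 hGA
  have hneg : ∑ g ∈ G, f g < 0 :=
    Finset.sum_neg' (fun g hg => hf.nonpos (hG hg)) ⟨g₀, hg₀, hf.2 g₀ (hG hg₀) hg₀A⟩
  have hcard : (0 : ℝ) < G.card := by exact_mod_cast Finset.card_pos.2 ⟨g₀, hg₀⟩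
  simp_rw [map_displacedCentroid]
  refine eventually_lt_of_lt (F := fun ε => (G.card : ℝ)⁻¹ * ∑ g ∈ G, f g + ε * f u)
    (by fun_prop) ?_
  simpa using mul_neg_of_pos_of_neg (inv_pos.2 hcard) hneg

theorem ExposedBy.insert_of_neg [DecidableEq E] (hf : ExposedBy V A f) (hy : f y < 0) :
    ExposedBy (insert y V) A f := by
  refine ⟨hf.1, fun w hw hA => ?_⟩
  rcases Finset.mem_insert.1 hw with rfl | hw
  · exact hy
  · exact hf.2 w hw hA

theorem IsFace.eventually_insert [DecidableEq E] (hF : IsFace V A) (hG : G ⊆ V) (hGA : ¬ G ⊆ A)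
    (u : E) : ∀ᶠ ε in 𝓝[>] (0 : ℝ), IsFace (insert (displacedCentroid G u ε) V) A := by
  obtain ⟨f, hf⟩ := hF
  filter_upwards [hf.eventually_neg hG hGA u] with ε hε
  exact ⟨f, hf.insert_of_neg hε⟩

theorem ExposedBy.map_displacedCentroid_eq (hf : ExposedBy V A f) (hGA : G ⊆ A) (ε : ℝ) :
    f (displacedCentroid G u ε) = ε * f u := by
  rw [map_displacedCentroid, Finset.sum_eq_zero fun g hg => hf.1 g (hGA hg)]
  simp

theorem height_displacedCentroid (hφ : ∀ v ∈ V, φ v = 1) (hG : G ⊆ V) (hGne : G.Nonempty)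
    (hu : φ u = 0) (ε : ℝ) : φ (displacedCentroid G u ε) = 1 := by
  have : (G.card : ℝ) ≠ 0 := by exact_mod_cast hGne.card_pos.ne'
  rw [map_displacedCentroid, Finset.sum_congr rfl fun g hg => hφ g (hG hg), hu]
  simp [this]

theorem ExposedBy.eventually_isFace_pair [DecidableEq E] (hφ : ∀ v ∈ V, φ v = 1) (hAV : A ⊆ V)
    (hf : ExposedBy V A f) (hGA : G ⊆ A) (hG : 2 ≤ G.card) (hu : φ u = 0) (hfu : 0 < f u)
    (hy : y ∈ A) (hhy : h y = 1) (hh : ∀ a ∈ A, a ≠ y → h a = 0) :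
    ∀ᶠ ε in 𝓝[>] (0 : ℝ), IsFace (insert (displacedCentroid G u ε) V)
      {displacedCentroid G u ε, y} := by
  have hGne : G.Nonempty := Finset.card_pos.1 (by omega)
  set κ : ℝ := (G.card : ℝ)⁻¹ * ∑ g ∈ G, h g with hκdef
  have hcard : (2 : ℝ) ≤ G.card := by exact_mod_cast hG
  have hκ : κ < 1 := by
    have hle : ∑ g ∈ G, h g ≤ 1 := by
      by_cases hyG : y ∈ G
      · rw [Finset.sum_eq_single_of_mem y hyG fun a ha hay => hh a (hGA ha) hay, hhy]
      · rw [Finset.sum_eq_zero fun a ha => hh a (hGA ha) fun hay => hyG (hay ▸ ha)]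
        exact zero_le_one
    rw [hκdef, inv_mul_lt_iff₀ (by linarith)]
    linarith
  set δ : ℝ → ℝ := fun ε => ε * f u / (1 - κ - ε * h u) with hδdef
  have hδc : ContinuousAt δ 0 := by
    refine ContinuousAt.div (by fun_prop) (by fun_prop) ?_
    simp only [zero_mul, sub_zero]
    linarith
  have hδ0 : δ 0 = 0 := by simp [hδdef]
  have hden : ∀ᶠ ε in 𝓝[>] (0 : ℝ), ε * h u < 1 - κ :=
    eventually_lt_of_lt (F := fun ε => ε * h u) (by fun_prop) (by simpa using hκ)
  have hneg : ∀ᶠ ε in 𝓝[>] (0 : ℝ), ∀ v ∈ V, v ∉ A → f v + δ ε * (h v - 1) < 0 := by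
    refine (Finset.eventually_all V).2 fun v hv => ?_
    by_cases hvA : v ∈ A
    · exact Eventually.of_forall fun ε h => absurd hvA h
    · refine (eventually_lt_of_lt (F := fun ε => f v + δ ε * (h v - 1)) (by fun_prop) ?_).mono
        fun ε h _ => h
      simpa [hδ0] using hf.2 v hv hvA
  filter_upwards [hden, hneg, self_mem_nhdsWithin] with ε hε hnegε hpos
  have hpos : 0 < ε := hpos
  have hden' : 0 < 1 - κ - ε * h u := by linarith
  have hδpos : 0 < δ ε := div_pos (mul_pos hpos hfu) hden'
  have hδeq : δ ε * (1 - κ - ε * h u) = ε * f u := div_mul_cancel₀ _ hden'.ne'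
  have hp : f (displacedCentroid G u ε) + δ ε * h (displacedCentroid G u ε)
      - δ ε * φ (displacedCentroid G u ε) = 0 := by
    rw [hf.map_displacedCentroid_eq hGA, height_displacedCentroid hφ (hGA.trans hAV) hGne hu,
      map_displacedCentroid]
    linarith
  refine ⟨f + δ ε • h - δ ε • φ, ?_, ?_⟩
  · intro a ha
    rcases Finset.mem_insert.1 ha with rfl | ha
    · simpa using hp
    · rw [Finset.mem_singleton.1 ha]
      simp [hf.1 y hy, hhy, hφ y (hAV hy)]
  · intro v hv hvn
    have hvn' : v ≠ displacedCentroid G u ε ∧ v ≠ y := by simpa using hvn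
    have hv := (Finset.mem_insert.1 hv).resolve_left hvn'.1
    have heq : (f + δ ε • h - δ ε • φ) v = f v + δ ε * (h v - 1) := by
      simp [hφ v hv]; ring
    rw [heq]
    by_cases hvA : v ∈ A
    · rw [hf.1 v hvA, hh v hvA hvn'.2]; linarith
    · exact hnegε v hv hvA

theorem ExposedBy.isFace_singleton [DecidableEq E] (hφ : ∀ v ∈ V, φ v = 1) (hAV : A ⊆ V)
    (hf : ExposedBy V A f) (hGA : G ⊆ A) (hG : G.Nonempty) (hu : φ u = 0) (hfu : 0 < f u)
    {ε : ℝ} (hε : 0 < ε) :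
    IsFace (insert (displacedCentroid G u ε) V) {displacedCentroid G u ε} := by
  refine ⟨f - (ε * f u) • φ, ?_, ?_⟩
  · intro a ha
    rw [Finset.mem_singleton.1 ha]
    simp [hf.map_displacedCentroid_eq hGA, height_displacedCentroid hφ (hGA.trans hAV) hG hu]
  · intro v hv hvn
    have hv := (Finset.mem_insert.1 hv).resolve_left (by simpa using hvn)
    simp [hφ v hv]
    linarith [hf.nonpos hv, mul_pos hε hfu]

theorem ExposedBy.displacedCentroid_notMem (hf : ExposedBy V A f) (hGA : G ⊆ A) (hfu : 0 < f u)
    {ε : ℝ} (hε : 0 < ε) : displacedCentroid G u ε ∉ V := by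
  intro hmem
  have := hf.nonpos hmem
  rw [hf.map_displacedCentroid_eq hGA] at this
  linarith [mul_pos hε hfu]

theorem eventually_not_isFace_pair [DecidableEq E] (hGV : G ⊆ V) (hGne : G.Nonempty) (hwG : w ∉ G)
    {μ : ℝ} {ν : E → ℝ} (hν : ∀ v ∈ V, v ∉ G → 0 ≤ ν v) (hνw : ν w = 0)
    (hsum : u + μ • w = ∑ v ∈ V, ν v • v) :
    ∀ᶠ ε in 𝓝[>] (0 : ℝ), displacedCentroid G u ε ∉ V →
      ¬ IsFace (insert (displacedCentroid G u ε) V) {displacedCentroid G u ε, w} := by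
  have hcard : (0 : ℝ) < G.card := by exact_mod_cast hGne.card_pos
  have hpos : ∀ᶠ ε in 𝓝[>] (0 : ℝ), ∀ g ∈ G, ε * (-ν g) < (G.card : ℝ)⁻¹ := by
    refine (Finset.eventually_all G).2 fun g _ => ?_
    exact eventually_lt_of_lt (F := fun ε => ε * (-ν g)) (by fun_prop) (by simpa using hcard)
  filter_upwards [hpos, self_mem_nhdsWithin] with ε hε hε0 hp
  have hε0 : 0 < ε := hε0
  rintro ⟨f, hf⟩
  have hf1 : f (displacedCentroid G u ε) = 0 := hf.1 _ (by simp)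
  have hf2 : f w = 0 := hf.1 _ (by simp)
  have hneg : ∀ v ∈ V, v ≠ w → f v < 0 := fun v hv hvw =>
    hf.2 v (Finset.mem_insert_of_mem hv) (by
      have : v ≠ displacedCentroid G u ε := fun h => hp (h ▸ hv)
      simp [this, hvw])
  have hfu : f u = ∑ v ∈ V, ν v * f v := by
    have := congrArg f hsum
    simpa [hf2] using this
  rw [map_displacedCentroid, hfu, ← Finset.sum_sdiff hGV, mul_add, add_left_comm,
    Finset.mul_sum, Finset.mul_sum, Finset.mul_sum, ← Finset.sum_add_distrib] at hf1
  have h1 : ∑ v ∈ V \ G, ε * (ν v * f v) ≤ 0 := by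
    refine Finset.sum_nonpos fun v hv => ?_
    obtain ⟨hv, hvG⟩ := Finset.mem_sdiff.1 hv
    by_cases hvw : v = w
    · simp [hvw, hνw]
    · exact mul_nonpos_of_nonneg_of_nonpos hε0.le
        (mul_nonpos_of_nonneg_of_nonpos (hν v hv hvG) (hneg v hv hvw).le)
  have h2 : ∑ g ∈ G, ((G.card : ℝ)⁻¹ * f g + ε * (ν g * f g)) < 0 := by
    refine Finset.sum_neg (fun g hg => ?_) hGne
    have h3 := hneg g (hGV hg) fun h => hwG (h ▸ hg)
    have h4 := hε g hg
    nlinarith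
  linarith

theorem IsConfiguration.eventually_insert [DecidableEq E] (hV : IsConfiguration φ V n e)
    (hG : G ⊆ V) (hG3 : 3 ≤ G.card) (hu : φ u = 0) (hNV : N ⊆ V) (hNne : N.Nonempty)
    (hN : ∀ y ∈ N, ∃ (A : Finset E) (f h : E →ₗ[ℝ] ℝ), G ⊆ A ∧ A ⊆ V ∧ ExposedBy V A f ∧
      0 < f u ∧ y ∈ A ∧ h y = 1 ∧ ∀ a ∈ A, a ≠ y → h a = 0)
    (hW : ∀ w ∈ V, w ∉ N → w ∉ G ∧ ∃ (μ : ℝ) (ν : E → ℝ), (∀ v ∈ V, v ∉ G → 0 ≤ ν v) ∧ ν w = 0 ∧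
      u + μ • w = ∑ v ∈ V, ν v • v) :
    ∀ᶠ ε in 𝓝[>] (0 : ℝ),
      IsConfiguration φ (insert (displacedCentroid G u ε) V) (n + 1) (e + N.card) := by
  have hGne : G.Nonempty := Finset.card_pos.1 (by omega)
  have hnsub : ∀ A : Finset E, A.card ≤ 2 → ¬ G ⊆ A := fun A hA hGA => by
    have := Finset.card_le_card hGA
    omega
  have hvert : ∀ᶠ ε in 𝓝[>] (0 : ℝ), ∀ v ∈ V, IsFace (insert (displacedCentroid G u ε) V) {v} :=
    (Finset.eventually_all V).2 fun v hv =>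
      (hV.vertex v hv).eventually_insert hG (hnsub _ (by simp)) u
  have hedge : ∀ᶠ ε in 𝓝[>] (0 : ℝ), ∀ A ∈ edgeSet V,
      IsFace (insert (displacedCentroid G u ε) V) A :=
    (Finset.eventually_all _).2 fun A hA =>
      (mem_edgeSet.1 hA).2.2.eventually_insert hG (hnsub _ (mem_edgeSet.1 hA).2.1.le) u
  have hnew : ∀ᶠ ε in 𝓝[>] (0 : ℝ), ∀ y ∈ N,
      IsFace (insert (displacedCentroid G u ε) V) {displacedCentroid G u ε, y} := by
    refine (Finset.eventually_all _).2 fun y hy => ?_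
    obtain ⟨A, f, h, hGA, hAV, hf, hfu, hyA, hhy, hh⟩ := hN y hy
    exact hf.eventually_isFace_pair hV.height hAV hGA (by omega) hu hfu hyA hhy hh
  have hnon : ∀ᶠ ε in 𝓝[>] (0 : ℝ), ∀ w ∈ V, w ∉ N → displacedCentroid G u ε ∉ V →
      ¬ IsFace (insert (displacedCentroid G u ε) V) {displacedCentroid G u ε, w} := by
    refine (Finset.eventually_all _).2 fun w hw => ?_
    by_cases hwN : w ∈ N
    · exact Eventually.of_forall fun ε h => absurd hwN h
    · obtain ⟨hwG, μ, ν, hν, hνw, hsum⟩ := hW w hw hwN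
      exact (eventually_not_isFace_pair hG hGne hwG hν hνw hsum).mono fun ε h _ => h
  obtain ⟨y₀, hy₀⟩ := hNne
  obtain ⟨A₀, f₀, -, hGA₀, hAV₀, hf₀, hfu₀, -⟩ := hN y₀ hy₀
  filter_upwards [hvert, hedge, hnew, hnon, self_mem_nhdsWithin] with ε hvert hedge hnew hnon hε
  have hpV : displacedCentroid G u ε ∉ V := hf₀.displacedCentroid_notMem hGA₀ hfu₀ hε
  have hset : edgeSet (insert (displacedCentroid G u ε) V) =
      edgeSet V ∪ N.image fun y => {displacedCentroid G u ε, y} := by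
    ext A
    rw [Finset.mem_union, Finset.mem_image, mem_edgeSet]
    constructor
    · rintro ⟨hA, hA2, hAf⟩
      by_cases hpA : displacedCentroid G u ε ∈ A
      · right
        obtain ⟨y, hyA⟩ : ∃ y, A.erase (displacedCentroid G u ε) = {y} :=
          Finset.card_eq_one.1 (by rw [Finset.card_erase_of_mem hpA, hA2])
        have hAeq : A = {displacedCentroid G u ε, y} := by
          rw [← Finset.insert_erase hpA, hyA]
        have hyne : y ∈ A.erase (displacedCentroid G u ε) := by simp [hyA]
        have hyV : y ∈ V := (Finset.mem_insert.1 (hA (Finset.mem_of_mem_erase hyne))).resolve_left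
          (Finset.ne_of_mem_erase hyne)
        refine ⟨y, ?_, hAeq.symm⟩
        by_contra hyN
        exact hnon y hyV hyN hpV (hAeq ▸ hAf)
      · left
        exact mem_edgeSet.2 ⟨(Finset.subset_insert_iff_of_notMem hpA).1 hA, hA2, hAf.of_insert⟩
    · rintro (hA | ⟨y, hy, rfl⟩)
      · exact ⟨(mem_edgeSet.1 hA).1.trans (Finset.subset_insert _ _), (mem_edgeSet.1 hA).2.1,
          hedge A hA⟩
      · refine ⟨?_, Finset.card_pair fun h => hpV (h ▸ hNV hy), hnew y hy⟩
        exact Finset.insert_subset_insert _ (Finset.singleton_subset_iff.2 (hNV hy))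
  refine ⟨?_, ?_, ?_, ?_, ?_⟩
  · intro v hv
    rcases Finset.mem_insert.1 hv with rfl | hv
    · exact height_displacedCentroid hV.height hG hGne hu ε
    · exact hV.height v hv
  · intro v hv
    rcases Finset.mem_insert.1 hv with rfl | hv
    · exact hf₀.isFace_singleton hV.height hAV₀ hGA₀ hGne hu hfu₀ hε
    · exact hvert v hv
  · rw [Finset.card_insert_of_notMem hpV, hV.card_vertices]
  · rw [hset, Finset.card_union_of_disjoint, hV.card_edges, Finset.card_image_of_injOn]
    · intro a ha b hb hab
      have hmem : a ∈ ({displacedCentroid G u ε, b} : Finset E) := by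
        simp only at hab
        simp [← hab]
      exact (Finset.mem_insert.1 hmem).elim (fun h => absurd (hNV ha) (h ▸ hpV))
        Finset.mem_singleton.1
    · rw [Finset.disjoint_left]
      intro A hA hA'
      obtain ⟨y, -, rfl⟩ := Finset.mem_image.1 hA'
      exact hpV ((mem_edgeSet.1 hA).1 (by simp))
  · rw [eq_top_iff, ← hV.span_eq_top]
    exact Submodule.span_mono (by simp)

theorem eq_smul_add_sum_smul (hE : Module.finrank ℝ E = 7) {q : E} {w : Fin 6 → E}
    {h : Fin 6 → E →ₗ[ℝ] ℝ} (hfq : f q = 1) (hfw : ∀ i, f (w i) = 0) (hhq : ∀ i, h i q = 0)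
    (hhw : ∀ i j, h i (w j) = if i = j then 1 else 0) (x : E) :
    x = f x • q + ∑ i, h i x • w i := by
  let L : E →ₗ[ℝ] (Fin 6 → ℝ) × ℝ := (LinearMap.pi h).prod f
  have hL : ∀ (a : Fin 6 → ℝ) (b : ℝ), L (b • q + ∑ i, a i • w i) = (a, b) := by
    intro a b
    refine Prod.ext (funext fun j => ?_) ?_
    · simp [L, hhw, hhq]
    · simp [L, hfw, hfq]
  have : FiniteDimensional ℝ E := FiniteDimensional.of_finrank_pos (by omega)
  have hinj : Function.Injective L := by
    rw [LinearMap.injective_iff_surjective_of_finrank_eq_finrank (by simp [hE])]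
    exact fun ⟨a, b⟩ => ⟨_, hL a b⟩
  exact hinj ((hL (fun i => h i x) (f x)).symm ▸ rfl)

/-- The points `w i` are the vertices of a simplex facet of `V`, exposed by `f`; the functionals
`h i` are dual to them. -/
structure IsSimplexFacet (V : Finset E) (w : Fin 6 → E) (h : Fin 6 → E →ₗ[ℝ] ℝ) (f : E →ₗ[ℝ] ℝ) :
    Prop where
  mem : ∀ i, w i ∈ V
  dual : ∀ i j, h i (w j) = if i = j then 1 else 0
  zero : ∀ i, f (w i) = 0
  neg : ∀ v ∈ V, (∀ i, v ≠ w i) → f v < 0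
  ne_zero : f ≠ 0

theorem IsSimplexFacet.exists_normal {w : Fin 6 → E} {h : Fin 6 → E →ₗ[ℝ] ℝ}
    (hF : IsSimplexFacet V w h f) (hE : Module.finrank ℝ E = 7) :
    ∃ q, f q = 1 ∧ (∀ i, h i q = 0) ∧ ∀ x, x = f x • q + ∑ i, h i x • w i := by
  obtain ⟨x₀, hx₀⟩ : ∃ x, f x ≠ 0 := by
    by_contra! hall
    exact hF.ne_zero (LinearMap.ext hall)
  set q₀ : E := (f x₀)⁻¹ • x₀
  have hq₀ : f q₀ = 1 := by simp [q₀, hx₀]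
  set q : E := q₀ - ∑ i, h i q₀ • w i
  have hfq : f q = 1 := by simp [q, hF.zero, hq₀]
  have hhq : ∀ i, h i q = 0 := fun i => by simp [q, hF.dual]
  refine ⟨q, hfq, hhq, eq_smul_add_sum_smul hE hfq hF.zero hhq hF.dual⟩

theorem IsConfiguration.exists_stack {w : Fin 6 → E} {h : Fin 6 → E →ₗ[ℝ] ℝ}
    (hV : IsConfiguration φ V n e) (hF : IsSimplexFacet V w h f) (hE : Module.finrank ℝ E = 7) :
    ∃ V' w' h' f', IsConfiguration φ V' (n + 1) (e + 6) ∧ IsSimplexFacet V' w' h' f' := by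
  classical
  obtain ⟨q, hfq, hhq, hq⟩ := hF.exists_normal hE
  set r : ℝ := φ q with hr
  have hφw : ∀ i, φ (w i) = 1 := fun i => hV.height _ (hF.mem i)
  have hwinj : Function.Injective w := fun i j hij => by
    have h1 := hF.dual i i
    rw [hij, hF.dual] at h1
    by_contra hne
    simp [hne] at h1
  set G : Finset E := Finset.univ.image w with hGdef
  have hGcard : G.card = 6 := by simp [hGdef, Finset.card_image_of_injective _ hwinj]
  have hGV : G ⊆ V := fun x hx => by
    obtain ⟨i, -, rfl⟩ := Finset.mem_image.1 hx
    exact hF.mem i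
  have hwG : ∀ i, w i ∈ G := fun i => Finset.mem_image_of_mem _ (Finset.mem_univ i)
  have hsumG : ∀ F : E → E, ∑ g ∈ G, F g = ∑ i, F (w i) := fun F =>
    Finset.sum_image fun i _ j _ hij => hwinj hij
  set u : E := q - (r / 6) • ∑ i, w i with hudef
  have hfu : f u = 1 := by simp [hudef, hF.zero, hfq]
  have hφu : φ u = 0 := by simp [hudef, hφw, ← hr]
  have hhu : ∀ i, h i u = -(r / 6) := fun i => by simp [hudef, hF.dual, hhq]
  have hexp : ExposedBy V G f := by
    refine ⟨fun g hg => ?_, fun v hv hvG => hF.neg v hv fun i hi => hvG (hi ▸ hwG i)⟩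
    obtain ⟨i, -, rfl⟩ := Finset.mem_image.1 hg
    exact hF.zero i
  have hconf := hV.eventually_insert (N := G) hGV (by omega) hφu hGV ⟨w 0, hwG 0⟩ ?_ ?_
  rotate_left
  · intro y hy
    obtain ⟨i, -, rfl⟩ := Finset.mem_image.1 hy
    refine ⟨G, f, h i, subset_rfl, hGV, hexp, by rw [hfu]; exact one_pos, hy, by simp [hF.dual], ?_⟩
    intro a ha hai
    obtain ⟨j, -, rfl⟩ := Finset.mem_image.1 ha
    rw [hF.dual, if_neg fun hij : i = j => hai (by rw [hij])]
  · intro x hx hxG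
    refine ⟨hxG, -(f x)⁻¹, fun v => if v ∈ G then ∑ i, if v = w i then
      -(r / 6) - (f x)⁻¹ * h i x else 0 else 0, fun v _ hv => by simp [hv], by simp [hxG], ?_⟩
    have hfx : f x ≠ 0 := (hexp.2 x hx hxG).ne
    have h1 : ∑ v ∈ V, (if v ∈ G then ∑ i, if v = w i then
        -(r / 6) - (f x)⁻¹ * h i x else 0 else (0 : ℝ)) • v =
        ∑ i, (-(r / 6) - (f x)⁻¹ * h i x) • w i := by
      rw [← Finset.sum_subset hGV fun v _ hv => by simp [hv], hsumG]
      refine Finset.sum_congr rfl fun i _ => ?_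
      simp [hwG, hwinj.eq_iff]
    rw [h1]
    have h2 : (f x)⁻¹ • x = q + ∑ i, ((f x)⁻¹ * h i x) • w i := by
      calc (f x)⁻¹ • x = (f x)⁻¹ • (f x • q + ∑ i, h i x • w i) := congrArg _ (hq x)
        _ = q + ∑ i, ((f x)⁻¹ * h i x) • w i := by
          rw [smul_add, smul_smul, inv_mul_cancel₀ hfx, one_smul, Finset.smul_sum]
          simp_rw [smul_smul]
    rw [neg_smul, h2]
    simp_rw [sub_smul, Finset.sum_sub_distrib, ← Finset.smul_sum, hudef]
    module
  have hη : ∀ᶠ ε in 𝓝[>] (0 : ℝ), ε * r < 1 :=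
    eventually_lt_of_lt (F := fun ε => ε * r) (by fun_prop) (by simp)
  have hneg : ∀ᶠ ε in 𝓝[>] (0 : ℝ), ∀ v ∈ V, v ∉ G →
      f v - ε / ((1 - ε * r) / 6) * h 0 v < 0 := by
    refine (Finset.eventually_all V).2 fun v hv => ?_
    by_cases hvG : v ∈ G
    · exact Eventually.of_forall fun ε h => absurd hvG h
    · have hc : ContinuousAt (fun ε : ℝ => ε / ((1 - ε * r) / 6)) 0 :=
        ContinuousAt.div (by fun_prop) (by fun_prop) (by norm_num)
      refine (eventually_lt_of_lt (F := fun ε => f v - ε / ((1 - ε * r) / 6) * h 0 v)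
        (by fun_prop) ?_).mono fun ε h _ => h
      simpa using hexp.2 v hv hvG
  obtain ⟨ε, hconf, hη, hneg, hε⟩ :=
    (hconf.and (hη.and (hneg.and (eventually_mem_nhdsWithin)))).exists
  have hε : 0 < ε := hε
  set p := displacedCentroid G u ε with hpdef
  set η : ℝ := (1 - ε * r) / 6 with hηdef
  have hηpos : 0 < η := by rw [hηdef]; linarith
  have hp : p = η • ∑ i, w i + ε • q := by
    rw [hpdef, displacedCentroid, hGcard, hsumG fun x => x, hudef, hηdef]
    module
  have hfp : f p = ε := by simp [hp, hF.zero, hfq]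
  have hhp : ∀ i, h i p = η := fun i => by simp [hp, hF.dual, hhq]
  refine ⟨insert p V, Function.update w 0 p,
    fun i => if i = 0 then η⁻¹ • h 0 else h i - h 0, f - (ε / η) • h 0, by rwa [hGcard] at hconf,
    ?_, ?_, ?_, ?_, ?_⟩
  · intro i
    by_cases hi : i = 0
    · subst hi; simp
    · simp [hi, hF.mem]
  · intro i j
    by_cases hi : i = 0 <;> by_cases hj : j = 0
    · subst hi hj; simp [hhp, hηpos.ne']
    · subst hi; simp [hj, hF.dual, Ne.symm hj]
    · subst hj; simp [hi, hhp]
    · simp [hi, hj, hF.dual, Ne.symm hj]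
  · intro i
    by_cases hi : i = 0
    · subst hi; simp [hfp, hhp, hηpos.ne']
    · simp [hi, hF.zero, hF.dual, Ne.symm hi]
  · intro v hv hne
    have hvp : v ≠ p := by simpa using hne 0
    have hv := (Finset.mem_insert.1 hv).resolve_left hvp
    by_cases hvG : v ∈ G
    · obtain ⟨i, -, rfl⟩ := Finset.mem_image.1 hvG
      by_cases hi : i = 0
      · subst hi
        simp [hF.zero, hF.dual, div_pos hε hηpos]
      · have := hne i
        simp [hi] at this
    · simpa using hneg v hv hvG
  · intro h0
    have := LinearMap.congr_fun h0 q
    simp [hfq, hhq] at this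

end Placing

section Truncation

open Filter Topology

variable {E : Type*} [AddCommGroup E] [Module ℝ E]

/-- The point `v` is a simple vertex of `V` with neighbours `w i`; the functionals `κ i` vanish
at `v`, are dual to the `w i` and nonnegative on `V`. -/
structure IsSimpleVertex [DecidableEq E] (V : Finset E) (v : E) (w : Fin 6 → E)
    (κ : Fin 6 → E →ₗ[ℝ] ℝ) : Prop where
  mem : v ∈ V
  mem_neighbour : ∀ i, w i ∈ V
  zero : ∀ i, κ i v = 0
  dual : ∀ i j, κ i (w j) = if i = j then 1 else 0
  nonneg : ∀ u ∈ V, ∀ i, 0 ≤ κ i u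
  isFace : ∀ i, IsFace V {v, w i}

variable [DecidableEq E] {φ : E →ₗ[ℝ] ℝ} {V : Finset E} {v : E} {w : Fin 6 → E}
  {κ : Fin 6 → E →ₗ[ℝ] ℝ} {n e : ℕ}

theorem IsSimpleVertex.eq_smul_add_sum_smul (hS : IsSimpleVertex V v w κ)
    (hφ : ∀ v ∈ V, φ v = 1) (hE : Module.finrank ℝ E = 7) (x : E) :
    x = (φ x - ∑ i, κ i x) • v + ∑ i, κ i x • w i := by
  have := _root_.eq_smul_add_sum_smul (f := φ - ∑ i, κ i) hE (q := v) (w := w) (h := κ)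
    (by simp [hS.zero, hφ v hS.mem])
    (fun j => by simp [hS.dual, hφ _ (hS.mem_neighbour j)]) hS.zero hS.dual x
  simpa using this

theorem IsSimpleVertex.mem_pair (hS : IsSimpleVertex V v w κ) (hφ : ∀ v ∈ V, φ v = 1)
    (hE : Module.finrank ℝ E = 7) {u : E} (hu : u ∈ V) (huv : u ≠ v)
    (hF : IsFace V {v, u}) : ∃ i, u = w i := by
  by_contra! hne
  obtain ⟨f, hf⟩ := hF
  have hfv : f v = 0 := hf.1 v (by simp)
  have hfu : f u = 0 := hf.1 u (by simp)
  have hfw : ∀ i, f (w i) < 0 := fun i => hf.2 _ (hS.mem_neighbour i) (by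
    have h1 : w i ≠ v := fun h => by
      have := hS.dual i i
      simp [h, hS.zero] at this
    simp [h1, (hne i).symm])
  have hsum := congrArg f (hS.eq_smul_add_sum_smul hφ hE u)
  simp only [map_add, map_smul, map_sum, hfv, hfu, smul_eq_mul, mul_zero, zero_add] at hsum
  have hzero := (Finset.sum_eq_zero_iff_of_nonpos fun i _ =>
    mul_nonpos_of_nonneg_of_nonpos (hS.nonneg u hu i) (hfw i).le).1 hsum.symm
  have hκ : ∀ i, κ i u = 0 := fun i =>
    (mul_eq_zero.1 (hzero i (Finset.mem_univ i))).resolve_right (hfw i).ne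
  refine huv ?_
  rw [hS.eq_smul_add_sum_smul hφ hE u]
  simp [hκ, hφ u hu]

theorem IsSimpleVertex.sum_pos (hS : IsSimpleVertex V v w κ) (hφ : ∀ v ∈ V, φ v = 1)
    (hE : Module.finrank ℝ E = 7) {u : E} (hu : u ∈ V) (huv : u ≠ v) : 0 < ∑ i, κ i u := by
  refine (Finset.sum_nonneg fun i _ => hS.nonneg u hu i).lt_of_ne fun h => huv ?_
  have hκ := (Finset.sum_eq_zero_iff_of_nonneg fun i _ => hS.nonneg u hu i).1 h.symm
  rw [hS.eq_smul_add_sum_smul hφ hE u, Finset.sum_eq_zero hκ,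
    Finset.sum_eq_zero fun i hi => by rw [hκ i hi, zero_smul]]
  simp [hφ u hu]

theorem IsConfiguration.exists_truncate (hV : IsConfiguration φ V n e)
    (hS : IsSimpleVertex V v w κ) (hE : Module.finrank ℝ E = 7) :
    ∃ V' v' w' κ' p h f, IsConfiguration φ V' (n + 5) (e + 15) ∧ IsSimpleVertex V' v' w' κ' ∧
      IsSimplexFacet V' p h f := by
  have hσ : ∀ u ∈ V.erase v, 0 < ∑ i, κ i u := fun u hu =>
    hS.sum_pos hV.height hE (Finset.mem_of_mem_erase hu) (Finset.ne_of_mem_erase hu)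
  obtain ⟨ε, hεσ, hε⟩ : ∃ ε : ℝ, (∀ u ∈ V.erase v, ε < ∑ i, κ i u) ∧ 0 < ε := by
    have : ∀ᶠ ε in 𝓝[>] (0 : ℝ), ∀ u ∈ V.erase v, ε < ∑ i, κ i u :=
      (Finset.eventually_all _).2 fun u hu =>
        eventually_lt_of_lt (F := fun ε => ε) continuousAt_id (hσ u hu)
    exact (this.and eventually_mem_nhdsWithin).exists
  set U := V.erase v with hU
  have hφv := hV.height v hS.mem
  have hwv : ∀ i, w i ≠ v := fun i h => by
    have := hS.dual i i
    simp [h, hS.zero] at this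
  have hwU : ∀ i, w i ∈ U := fun i => Finset.mem_erase.2 ⟨hwv i, hS.mem_neighbour i⟩
  have hφU : ∀ u ∈ U, φ u = 1 := fun u hu => hV.height u (Finset.mem_of_mem_erase hu)
  have hε1 : ε < 1 := by simpa [hS.dual] using hεσ _ (hwU 0)
  set p : Fin 6 → E := fun i => (1 - ε) • v + ε • w i with hp
  have hfp : ∀ (f : E →ₗ[ℝ] ℝ) i, f (p i) = (1 - ε) * f v + ε * f (w i) := fun f i => by simp [hp]
  have hκp : ∀ i j, κ i (p j) = if i = j then ε else 0 := fun i j => by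
    simp [hfp, hS.zero, hS.dual]
  have hφp : ∀ j, φ (p j) = 1 := fun j => by
    rw [hfp, hφv, hφU _ (hwU j)]; ring
  have hpU : ∀ j, p j ∉ U := fun j hj => by simpa [hκp] using hεσ _ hj
  have hpinj : Function.Injective p := fun i j hij => by
    have h1 := hκp i i
    rw [hij, hκp] at h1
    by_contra hne
    simp [hne, hε.ne] at h1
  set V' := U ∪ Finset.univ.image p with hV'
  have hpV' : ∀ j, p j ∈ V' := fun j =>
    Finset.mem_union_right _ (Finset.mem_image_of_mem _ (Finset.mem_univ j))
  have hUV' : U ⊆ V' := Finset.subset_union_left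
  have hcases : ∀ x ∈ V', x ∈ U ∨ ∃ i, x = p i := fun x hx => by
    rcases Finset.mem_union.1 hx with h | h
    · exact Or.inl h
    · obtain ⟨i, -, rfl⟩ := Finset.mem_image.1 h
      exact Or.inr ⟨i, rfl⟩
  have hkey : ∀ (f : E →ₗ[ℝ] ℝ), ∀ u ∈ U,
      ε * f u = (ε - ∑ i, κ i u) * f v + ∑ i, κ i u * f (p i) := by
    intro f u hu
    have h1 := congrArg f (hS.eq_smul_add_sum_smul hV.height hE u)
    simp only [map_add, map_smul, map_sum, smul_eq_mul, hφU u hu] at h1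
    simp_rw [hfp, mul_add, Finset.sum_add_distrib, ← Finset.sum_mul, mul_left_comm _ ε,
      ← Finset.mul_sum]
    rw [h1]
    ring
  have hold : ∀ A ⊆ U, IsFace V A → IsFace V' A := by
    rintro A hA ⟨f, hf⟩
    refine ⟨f, hf.1, fun x hx hxA => ?_⟩
    rcases hcases x hx with h | ⟨i, rfl⟩
    · exact hf.2 x (Finset.mem_of_mem_erase h) hxA
    · have h1 := hf.2 v hS.mem fun h => absurd rfl (Finset.ne_of_mem_erase (hA h))
      have h2 := hf.nonpos (hS.mem_neighbour i)
      rw [hfp]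
      nlinarith
  have hback : ∀ A ⊆ U, A.Nonempty → IsFace V' A → IsFace V A := by
    rintro A hA ⟨u, hu⟩ ⟨f, hf⟩
    refine ⟨f, hf.1, fun x hx hxA => ?_⟩
    by_cases hxv : x = v
    · subst hxv
      by_contra! hfv
      have h1 := hkey f u (hA hu)
      have h2 : ∑ i, κ i u * f (p i) ≤ 0 := Finset.sum_nonpos fun i _ =>
        mul_nonpos_of_nonneg_of_nonpos (hS.nonneg u (Finset.mem_of_mem_erase (hA hu)) i)
          (hf.nonpos (hpV' i))
      have h3 := hεσ u (hA hu)
      have h4 : ∃ i, 0 < κ i u := by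
        by_contra! hall
        exact (hσ u (hA hu)).not_ge (Finset.sum_nonpos fun i _ => hall i)
      obtain ⟨i, hi⟩ := h4
      have h5 : ∑ i, κ i u * f (p i) < 0 := by
        refine Finset.sum_neg' (fun i _ => mul_nonpos_of_nonneg_of_nonpos
          (hS.nonneg u (Finset.mem_of_mem_erase (hA hu)) i) (hf.nonpos (hpV' i)))
          ⟨i, Finset.mem_univ i, mul_neg_of_pos_of_neg hi (hf.2 _ (hpV' i) fun h => hpU i (hA h))⟩
      rw [hf.1 u hu] at h1
      nlinarith
    · exact hf.2 x (hUV' (Finset.mem_erase.2 ⟨hxv, hx⟩)) hxA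
  have hnewold : ∀ i, IsFace V' {p i, w i} := by
    intro i
    obtain ⟨f, hf⟩ := hS.isFace i
    have hfv : f v = 0 := hf.1 v (by simp)
    have hfw : f (w i) = 0 := hf.1 _ (by simp)
    refine ⟨f, ?_, fun x hx hxA => ?_⟩
    · intro x hx
      rcases Finset.mem_insert.1 hx with rfl | hx
      · rw [hfp, hfv, hfw]; ring
      · rw [Finset.mem_singleton.1 hx, hfw]
    · have hxp : x ≠ p i ∧ x ≠ w i := by simpa using hxA
      rcases hcases x hx with h | ⟨j, rfl⟩
      · exact hf.2 x (Finset.mem_of_mem_erase h) (by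
          simp [hxp.2, Finset.ne_of_mem_erase h])
      · have hij : w j ≠ w i := fun h => hxp.1 (by simp [hp, h])
        have := hf.2 (w j) (hS.mem_neighbour j) (by simp [hij, hwv])
        rw [hfp, hfv]
        nlinarith
  have hnew : ∀ S : Finset (Fin 6), IsFace V' (S.image p) := by
    intro S
    refine ⟨ε • φ - ∑ i, κ i - ∑ k ∈ Sᶜ, κ k, ?_, ?_⟩
    · intro x hx
      obtain ⟨i, hi, rfl⟩ := Finset.mem_image.1 hx
      simp [hφp, hκp, hi]
    · intro x hx hxS
      rcases hcases x hx with h | ⟨j, rfl⟩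
      · have h1 : 0 ≤ ∑ k ∈ Sᶜ, κ k x :=
          Finset.sum_nonneg fun k _ => hS.nonneg x (Finset.mem_of_mem_erase h) k
        have h2 := hεσ x h
        simp [hφU x h]
        linarith
      · have hjS : j ∉ S := fun h => hxS (Finset.mem_image_of_mem _ h)
        simp [hφp, hκp, hjS, hε]
  have hmixed : ∀ i, ∀ u ∈ U, IsFace V' {p i, u} → u = w i := by
    rintro i u hu ⟨f, hf⟩
    by_contra hne
    have hfpi : f (p i) = 0 := hf.1 _ (by simp)
    have hfu : f u = 0 := hf.1 _ (by simp)
    have hfw : f (w i) < 0 := hf.2 _ (hUV' (hwU i)) (by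
      have h1 : w i ≠ p i := fun h => hpU i (h ▸ hwU i)
      simp [h1, Ne.symm hne])
    have h1 := hkey f u hu
    have h2 : ∑ i, κ i u * f (p i) ≤ 0 := Finset.sum_nonpos fun i _ =>
      mul_nonpos_of_nonneg_of_nonpos (hS.nonneg u (Finset.mem_of_mem_erase hu) i)
        (hf.nonpos (hpV' i))
    have h3 := hεσ u hu
    rw [hfp] at hfpi
    have h4 : 0 < f v := by
      by_contra! h
      nlinarith
    rw [hfu] at h1
    nlinarith
  set E₀ := (edgeSet V).filter (v ∉ ·) with hE₀
  set E₁ : Finset (Finset E) := Finset.univ.image fun i => {p i, w i} with hE₁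
  set E₂ := (Finset.powersetCard 2 (Finset.univ : Finset (Fin 6))).image (Finset.image p) with hE₂
  have hpair : ∀ i j, p i ∈ ({p j, w j} : Finset E) → i = j := fun i j h => by
    rcases Finset.mem_insert.1 h with h | h
    · exact hpinj h
    · exact absurd (hwU j) (Finset.mem_singleton.1 h ▸ hpU i)
  have hcardE : e = E₀.card + 6 := by
    have hsplit : edgeSet V = E₀ ∪ Finset.univ.image fun i => {v, w i} := by
      ext A
      rw [Finset.mem_union, hE₀, Finset.mem_filter, Finset.mem_image]
      constructor
      · intro hA
        by_cases hvA : v ∈ A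
        · right
          obtain ⟨hAV, hA2, hAf⟩ := mem_edgeSet.1 hA
          obtain ⟨y, hyA⟩ : ∃ y, A.erase v = {y} :=
            Finset.card_eq_one.1 (by rw [Finset.card_erase_of_mem hvA, hA2])
          have hAeq : A = {v, y} := by rw [← Finset.insert_erase hvA, hyA]
          have hy : y ∈ A.erase v := by simp [hyA]
          obtain ⟨i, hi⟩ := hS.mem_pair hV.height hE (hAV (Finset.mem_of_mem_erase hy))
            (Finset.ne_of_mem_erase hy) (hAeq ▸ hAf)
          exact ⟨i, Finset.mem_univ i, by rw [hAeq, hi]⟩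
        · exact Or.inl ⟨hA, hvA⟩
      · rintro (⟨hA, -⟩ | ⟨i, -, rfl⟩)
        · exact hA
        · refine mem_edgeSet.2 ⟨?_, Finset.card_pair (hwv i).symm, hS.isFace i⟩
          simp [Finset.insert_subset_iff, hS.mem, hS.mem_neighbour]
    rw [← hV.card_edges, hsplit, Finset.card_union_of_disjoint, Finset.card_image_of_injective]
    · simp
    · intro i j hij
      have h1 : w i ∈ ({v, w j} : Finset E) := by
        simp only at hij
        simp [← hij]
      have h2 : w i = w j := by simpa [hwv] using h1
      exact hpinj (by simp [hp, h2])
    · rw [Finset.disjoint_left]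
      intro A hA hA'
      obtain ⟨i, -, rfl⟩ := Finset.mem_image.1 hA'
      exact (Finset.mem_filter.1 hA).2 (by simp)
  have hE₀U : ∀ A ∈ E₀, A ⊆ U := fun A hA x hx => by
    obtain ⟨hA, hvA⟩ := Finset.mem_filter.1 hA
    exact Finset.mem_erase.2 ⟨fun h => hvA (h ▸ hx), (mem_edgeSet.1 hA).1 hx⟩
  have hedges : edgeSet V' = E₀ ∪ E₁ ∪ E₂ := by
    ext A
    rw [mem_edgeSet, Finset.mem_union, Finset.mem_union]
    constructor
    · rintro ⟨hAV, hA2, hAf⟩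
      obtain ⟨a, b, hab, rfl⟩ := Finset.card_eq_two.1 hA2
      have ha := hcases a (hAV (by simp))
      have hb := hcases b (hAV (by simp))
      rcases ha with ha | ⟨i, rfl⟩ <;> rcases hb with hb | ⟨j, rfl⟩
      · have hsub : ({a, b} : Finset E) ⊆ U := by simp [Finset.insert_subset_iff, ha, hb]
        refine Or.inl (Or.inl (Finset.mem_filter.2 ⟨mem_edgeSet.2 ⟨hsub.trans
          (Finset.erase_subset _ _), hA2, hback _ hsub (by simp) hAf⟩, fun h => ?_⟩))
        exact absurd rfl (Finset.ne_of_mem_erase (hsub h))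
      · rw [Finset.pair_comm] at hAf ⊢
        rw [hmixed j a ha hAf]
        exact Or.inl (Or.inr (Finset.mem_image_of_mem _ (Finset.mem_univ j)))
      · rw [hmixed i b hb hAf]
        exact Or.inl (Or.inr (Finset.mem_image_of_mem (fun i => {p i, w i}) (Finset.mem_univ i)))
      · refine Or.inr (Finset.mem_image.2 ⟨{i, j}, ?_, by simp [Finset.image_insert]⟩)
        exact Finset.mem_powersetCard.2
          ⟨Finset.subset_univ _, Finset.card_pair fun h => hab (by rw [h])⟩
    · rintro ((hA | hA) | hA)
      · have hAE := mem_edgeSet.1 (Finset.mem_filter.1 hA).1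
        exact ⟨(hE₀U A hA).trans hUV', hAE.2.1, hold A (hE₀U A hA) hAE.2.2⟩
      · obtain ⟨i, -, rfl⟩ := Finset.mem_image.1 hA
        refine ⟨?_, Finset.card_pair fun h => hpU i (h ▸ hwU i), hnewold i⟩
        simp [Finset.insert_subset_iff, hpV', hUV' (hwU i)]
      · obtain ⟨S, hS2, rfl⟩ := Finset.mem_image.1 hA
        refine ⟨fun x hx => ?_, ?_, hnew S⟩
        · obtain ⟨i, -, rfl⟩ := Finset.mem_image.1 hx
          exact hpV' i
        · rw [Finset.card_image_of_injective _ hpinj, (Finset.mem_powersetCard.1 hS2).2]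
  have hpairface : ∀ i j, IsFace V' {p i, p j} := fun i j => by
    simpa [Finset.image_insert] using hnew {i, j}
  refine ⟨V', p 0, Function.update p 0 (w 0), fun i => if i = 0 then
    (1 - ε)⁻¹ • (∑ i, κ i - ε • φ) else ε⁻¹ • κ i, p, fun i => ε⁻¹ • κ i, ε • φ - ∑ i, κ i,
    ⟨?_, ?_, ?_, ?_, ?_⟩, ⟨hpV' 0, ?_, ?_, ?_, ?_, ?_⟩, ⟨hpV', ?_, ?_, ?_, ?_⟩⟩
  · intro x hx
    rcases hcases x hx with h | ⟨i, rfl⟩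
    · exact hφU x h
    · exact hφp i
  · intro x hx
    rcases hcases x hx with h | ⟨i, rfl⟩
    · exact hold _ (by simpa using h) (hV.vertex x (Finset.mem_of_mem_erase h))
    · simpa using hnew {i}
  · have h1 : Disjoint U (Finset.univ.image p) := by
      rw [Finset.disjoint_left]
      intro x hx hx'
      obtain ⟨i, -, rfl⟩ := Finset.mem_image.1 hx'
      exact hpU i hx
    have h2 : U.card + 1 = n := by rw [hU, Finset.card_erase_add_one hS.mem, hV.card_vertices]
    rw [hV', Finset.card_union_of_disjoint h1, Finset.card_image_of_injective _ hpinj]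
    simp
    omega
  · have h01 : Disjoint E₀ E₁ := by
      rw [Finset.disjoint_left]
      intro A hA hA'
      obtain ⟨i, -, rfl⟩ := Finset.mem_image.1 hA'
      exact hpU i (hE₀U _ hA (by simp))
    have h2 : Disjoint (E₀ ∪ E₁) E₂ := by
      rw [Finset.disjoint_left]
      intro A hA hA'
      obtain ⟨S, hS2, rfl⟩ := Finset.mem_image.1 hA'
      have hcard := (Finset.mem_powersetCard.1 hS2).2
      rcases Finset.mem_union.1 hA with hA | hA
      · obtain ⟨i, hi⟩ := Finset.card_pos.1 (by omega : 0 < S.card)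
        exact hpU i (hE₀U _ hA (Finset.mem_image_of_mem _ hi))
      · obtain ⟨i, -, hi⟩ := Finset.mem_image.1 hA
        have : w i ∈ S.image p := by
          simp [← hi]
        obtain ⟨j, -, hj⟩ := Finset.mem_image.1 this
        exact hpU j (hj ▸ hwU i)
    rw [hedges, Finset.card_union_of_disjoint h2, Finset.card_union_of_disjoint h01, hE₁, hE₂,
      Finset.card_image_of_injective, Finset.card_image_of_injective _
      (Finset.image_injective hpinj), Finset.card_powersetCard, hcardE]
    · simp [Nat.choose]
    · intro i j hij
      refine hpair i j ?_
      simp only at hij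
      simp [← hij]
  · rw [eq_top_iff, ← hV.span_eq_top, Submodule.span_le]
    intro x hx
    by_cases hxv : x = v
    · subst hxv
      have h1 : x = (1 - ε)⁻¹ • (p 0 - ε • w 0) := by
        rw [hp]
        simp [smul_smul, inv_mul_cancel₀ (sub_ne_zero.2 hε1.ne')]
      rw [h1]
      exact Submodule.smul_mem _ _ (Submodule.sub_mem _ (Submodule.subset_span (hpV' 0))
        (Submodule.smul_mem _ _ (Submodule.subset_span (hUV' (hwU 0)))))
    · exact Submodule.subset_span (hUV' (Finset.mem_erase.2 ⟨hxv, hx⟩))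
  · intro i
    by_cases hi : i = 0
    · subst hi; simpa using hUV' (hwU 0)
    · simpa [hi] using hpV' i
  · intro i
    by_cases hi : i = 0
    · subst hi; simp [hφp, hκp]
    · simp [hi, hκp]
  · intro i j
    have h1 : 1 - ε ≠ 0 := sub_ne_zero.2 hε1.ne'
    by_cases hi : i = 0 <;> by_cases hj : j = 0
    · subst hi hj; simp [hS.dual, hφU _ (hwU 0), h1]
    · subst hi; simp [hj, Ne.symm hj, hφp, hκp]
    · subst hj; simp [hi, hS.dual]
    · by_cases hij : i = j
      · subst hij; simp [hi, hκp, hε.ne']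
      · simp [hi, hj, hκp, hij]
  · intro x hx i
    have hκx : 0 ≤ κ i x := by
      rcases hcases x hx with h | ⟨j, rfl⟩
      · exact hS.nonneg x (Finset.mem_of_mem_erase h) i
      · rw [hκp]; split_ifs <;> linarith
    by_cases hi : i = 0
    · subst hi
      have h1 : 0 ≤ ∑ i, κ i x - ε * φ x := by
        rcases hcases x hx with h | ⟨j, rfl⟩
        · rw [hφU x h]; linarith [hεσ x h]
        · simp [hκp, hφp]
      simpa using mul_nonneg (inv_nonneg.2 (sub_nonneg.2 hε1.le)) h1
    · simpa [hi] using mul_nonneg (inv_nonneg.2 hε.le) hκx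
  · intro i
    by_cases hi : i = 0
    · subst hi; simpa using hnewold 0
    · simpa [hi] using hpairface 0 i
  · intro i j
    by_cases hij : i = j
    · subst hij; simp [hκp, hε.ne']
    · simp [hκp, hij]
  · intro i
    simp [hφp, hκp]
  · intro x hx hne
    rcases hcases x hx with h | ⟨i, rfl⟩
    · simpa [hφU x h] using hεσ x h
    · exact absurd rfl (hne i)
  · intro h
    have := LinearMap.congr_fun h v
    simp [hφv, hS.zero, hε.ne'] at this

end Truncation

section MomentCurve

open Filter Topology Polynomial

/-- The functional on `Fin 7 → ℝ` given by the first seven coefficients of `q`. -/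
noncomputable def coeffFunctional (q : ℝ[X]) : (Fin 7 → ℝ) →ₗ[ℝ] ℝ :=
  ∑ i : Fin 7, q.coeff i • LinearMap.proj i

/-- The point with parameter `j` on the moment curve. -/
noncomputable def momentPoint (j : ℕ) : Fin 7 → ℝ := fun i => (j : ℝ) ^ (i : ℕ)

theorem coeffFunctional_momentPoint {q : ℝ[X]} (hq : q.natDegree ≤ 6) (j : ℕ) :
    coeffFunctional q (momentPoint j) = q.eval (j : ℝ) := by
  rw [eval_eq_sum_range' (Nat.lt_succ_of_le hq), Finset.sum_range]
  simp [coeffFunctional, momentPoint]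

theorem momentPoint_injective : Function.Injective momentPoint := fun i j h => by
  have := congrFun h 1
  simpa [momentPoint] using this

theorem injOn_natCast (S : Finset ℕ) : Set.InjOn (fun j : ℕ => (j : ℝ)) S :=
  Nat.cast_injective.injOn

theorem momentPoint_eq_sum (S : Finset ℕ) (hS : S.card = 7) (t : ℕ) :
    momentPoint t =
      ∑ i ∈ S, (Lagrange.basis S (fun j : ℕ => (j : ℝ)) i).eval (t : ℝ) • momentPoint i := by
  funext k
  have h := Lagrange.eq_interpolate (f := (X : ℝ[X]) ^ (k : ℕ)) (injOn_natCast S) (by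
    rw [degree_X_pow, hS]
    exact_mod_cast k.2)
  have h1 := congrArg (eval (t : ℝ)) h
  rw [Lagrange.interpolate_apply, eval_finsetSum] at h1
  simpa [momentPoint, mul_comm] using h1

/-- The functional vanishing at the points of `S` on the moment curve other than `y`. -/
noncomputable def basisFunctional (S : Finset ℕ) (y : ℕ) : (Fin 7 → ℝ) →ₗ[ℝ] ℝ :=
  coeffFunctional (Lagrange.basis S (fun j : ℕ => (j : ℝ)) y)

theorem basisFunctional_momentPoint {S : Finset ℕ} (hS : S.card ≤ 7) {y : ℕ} (hy : y ∈ S) {j : ℕ}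
    (hj : j ∈ S) : basisFunctional S y (momentPoint j) = if y = j then 1 else 0 := by
  rw [basisFunctional, coeffFunctional_momentPoint
    (by rw [Lagrange.natDegree_basis (injOn_natCast S) hy]; omega)]
  split_ifs with h
  · subst h
    exact Lagrange.eval_basis_self (injOn_natCast S) hy
  · exact Lagrange.eval_basis_of_ne h hj

/-- The vertices of a cyclic polytope. -/
noncomputable def cyclicVertices (N : ℕ) : Finset (Fin 7 → ℝ) :=
  (Finset.Icc 1 N).image momentPoint

theorem momentPoint_mem_cyclicVertices {N j : ℕ} :
    momentPoint j ∈ cyclicVertices N ↔ 1 ≤ j ∧ j ≤ N := by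
  simp [cyclicVertices, momentPoint_injective.eq_iff]

theorem exposedBy_cyclicVertices {N : ℕ} {S : Finset ℕ} {q : ℝ[X]} (hq : q.natDegree ≤ 6)
    (h0 : ∀ j ∈ S, q.eval (j : ℝ) = 0) (hneg : ∀ j : ℕ, 1 ≤ j → j ∉ S → q.eval (j : ℝ) < 0) :
    ExposedBy (cyclicVertices N) (S.image momentPoint) (coeffFunctional q) := by
  refine ⟨fun a ha => ?_, fun w hw hwS => ?_⟩
  · obtain ⟨j, hj, rfl⟩ := Finset.mem_image.1 ha
    rw [coeffFunctional_momentPoint hq, h0 j hj]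
  · obtain ⟨j, hj, rfl⟩ := Finset.mem_image.1 hw
    rw [coeffFunctional_momentPoint hq]
    exact hneg j (Finset.mem_Icc.1 hj).1 fun h => hwS (Finset.mem_image_of_mem _ h)

theorem natCast_sub_natCast_ne_zero {i j : ℕ} (h : i ≠ j) : (i : ℝ) - j ≠ 0 :=
  sub_ne_zero.2 (Nat.cast_injective.ne h)

theorem isConfiguration_cyclicVertices {N : ℕ} (hN : 7 ≤ N) :
    IsConfiguration (LinearMap.proj 0) (cyclicVertices N) N (N.choose 2) := by
  have hcard : (cyclicVertices N).card = N := by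
    rw [cyclicVertices, Finset.card_image_of_injective _ momentPoint_injective]
    simp
  refine ⟨?_, ?_, hcard, ?_, ?_⟩
  · intro v hv
    obtain ⟨j, -, rfl⟩ := Finset.mem_image.1 hv
    simp [momentPoint]
  · intro v hv
    obtain ⟨j, -, rfl⟩ := Finset.mem_image.1 hv
    refine ⟨coeffFunctional (-(X - C (j : ℝ)) ^ 2), ?_⟩
    rw [← Finset.image_singleton]
    refine exposedBy_cyclicVertices ?_ (by simp) ?_
    · refine le_trans (b := 2) ?_ (by norm_num)
      compute_degree
    · intro i _ hi
      have h := natCast_sub_natCast_ne_zero (by simpa using hi : i ≠ j)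
      simp
      positivity
  · have : edgeSet (cyclicVertices N) = (cyclicVertices N).powersetCard 2 := by
      ext A
      rw [mem_edgeSet, Finset.mem_powersetCard]
      refine ⟨fun h => ⟨h.1, h.2.1⟩, fun h => ⟨h.1, h.2, ?_⟩⟩
      obtain ⟨a, b, -, rfl⟩ := Finset.card_eq_two.1 h.2
      obtain ⟨i, -, rfl⟩ := Finset.mem_image.1 (h.1 (by simp : a ∈ _))
      obtain ⟨j, -, rfl⟩ := Finset.mem_image.1 (h.1 (by simp : b ∈ _))
      refine ⟨coeffFunctional (-((X - C (i : ℝ)) * (X - C (j : ℝ))) ^ 2), ?_⟩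
      rw [← Finset.image_singleton, ← Finset.image_insert]
      refine exposedBy_cyclicVertices ?_ (by simp) ?_
      · refine le_trans (b := 4) ?_ (by norm_num)
        compute_degree
      · intro k _ hk
        rw [Finset.mem_insert, Finset.mem_singleton, not_or] at hk
        have h1 := natCast_sub_natCast_ne_zero hk.1
        have h2 := natCast_sub_natCast_ne_zero hk.2
        simp
        positivity
    rw [this, Finset.card_powersetCard, hcard]
  · have hinj : Function.Injective fun i : Fin 7 => (((i : ℕ) + 1 : ℕ) : ℝ) := fun i j h => by
      have : (i : ℕ) + 1 = (j : ℕ) + 1 := Nat.cast_injective h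
      omega
    have hli := Matrix.linearIndependent_rows_of_det_ne_zero
      (Matrix.det_vandermonde_ne_zero_iff.2 hinj)
    rw [eq_top_iff, ← hli.span_eq_top_of_card_eq_finrank' (by simp)]
    refine Submodule.span_mono ?_
    rintro _ ⟨i, rfl⟩
    exact (momentPoint_mem_cyclicVertices (j := (i : ℕ) + 1)).2 (by omega)

theorem prod_insert_four {a b : ℕ} (ha : 4 < a) (hab : a < b) (F : ℕ → ℝ) :
    ∏ j ∈ ({1, 2, 3, 4, a, b} : Finset ℕ), F j = F 1 * F 2 * F 3 * F 4 * F a * F b := by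
  rw [Finset.prod_insert, Finset.prod_insert, Finset.prod_insert, Finset.prod_insert,
    Finset.prod_insert, Finset.prod_singleton]
  · ring
  all_goals simp only [Finset.mem_insert, Finset.mem_singleton]; omega

/-- The polynomial `(X - 1)(X - 2)(X - 3)(X - 4)`, as a function. -/
def quartic (t : ℝ) : ℝ := (t - 1) * (t - 2) * (t - 3) * (t - 4)

theorem quartic_pos {t : ℝ} (ht : 4 < t) : 0 < quartic t := by
  have h1 : 0 < t - 1 := by linarith
  have h2 : 0 < t - 2 := by linarith
  have h3 : 0 < t - 3 := by linarith
  have h4 : 0 < t - 4 := by linarith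
  unfold quartic
  positivity

/-- The facet polynomial of a cyclic polytope with nodes `1, 2, 3, 4, k, k + 1`. -/
noncomputable def facetPolynomial (k : ℕ) : ℝ[X] :=
  -((X - C 1) * (X - C 2) * (X - C 3) * (X - C 4) * (X - C (k : ℝ)) * (X - C ((k : ℝ) + 1)))

theorem natDegree_facetPolynomial_le (k : ℕ) : (facetPolynomial k).natDegree ≤ 6 := by
  unfold facetPolynomial
  compute_degree

theorem eval_facetPolynomial (k : ℕ) (t : ℝ) :
    (facetPolynomial k).eval t = -(quartic t * (t - k) * (t - (k + 1))) := by
  simp [facetPolynomial, quartic]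

theorem exposedBy_facetPolynomial (N k : ℕ) :
    ExposedBy (cyclicVertices N) (({1, 2, 3, 4, k, k + 1} : Finset ℕ).image momentPoint)
      (coeffFunctional (facetPolynomial k)) := by
  refine exposedBy_cyclicVertices (natDegree_facetPolynomial_le k) ?_ ?_
  · intro j hj
    rw [eval_facetPolynomial, quartic]
    simp only [Finset.mem_insert, Finset.mem_singleton] at hj
    rcases hj with rfl | rfl | rfl | rfl | rfl | rfl <;> simp
  · intro j hj1 hj
    simp only [Finset.mem_insert, Finset.mem_singleton, not_or] at hj
    rw [eval_facetPolynomial, neg_lt_zero, mul_assoc]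
    have h1 : (4 : ℝ) < j := by exact_mod_cast (by omega : 4 < j)
    refine mul_pos (quartic_pos h1) ?_
    rcases lt_or_ge j k with h | h
    · have : (j : ℝ) + 1 ≤ k := by exact_mod_cast h
      nlinarith
    · have : (k : ℝ) + 1 + 1 ≤ j := by exact_mod_cast (by omega : k + 1 + 1 ≤ j)
      nlinarith

/-- The coefficient of `momentPoint m` in `moveDirection m`. -/
noncomputable def moveCoeff (m : ℕ) : ℝ := (m - 4) / ((m - 5) * quartic m)

/-- A direction seeing exactly the facets with nodes `1, 2, 3, 4, k, k + 1` for `5 ≤ k < m`. -/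
noncomputable def moveDirection (m : ℕ) : Fin 7 → ℝ :=
  moveCoeff m • momentPoint m - (quartic (m + 1))⁻¹ • momentPoint (m + 1) -
    (moveCoeff m - (quartic (m + 1))⁻¹) • momentPoint 1

theorem facetPolynomial_moveDirection_pos {m k : ℕ} (hk : 5 ≤ k) (hkm : k + 1 ≤ m) :
    0 < coeffFunctional (facetPolynomial k) (moveDirection m) := by
  have hm : (k : ℝ) + 1 ≤ m := by exact_mod_cast hkm
  have hk' : (5 : ℝ) ≤ k := by exact_mod_cast hk
  have h5 : (0 : ℝ) < m - 5 := by linarith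
  have hq := quartic_pos (t := m) (by linarith)
  have hq' := quartic_pos (t := m + 1) (by linarith)
  have h1 : quartic 1 = 0 := by simp [quartic]
  simp only [moveDirection, map_sub, map_smul, smul_eq_mul,
    coeffFunctional_momentPoint (natDegree_facetPolynomial_le k), eval_facetPolynomial, moveCoeff]
  push_cast
  rw [h1]
  have : (m - 4) / ((m - 5) * quartic m) * -(quartic m * (m - k) * (m - (k + 1))) -
      (quartic (m + 1))⁻¹ * -(quartic (m + 1) * (m + 1 - k) * (m + 1 - (k + 1))) -
      ((m - 4) / ((m - 5) * quartic m) - (quartic (m + 1))⁻¹) * -(0 * (1 - k) * (1 - (k + 1))) =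
      (m - k) * (m + k - 9) / (m - 5 : ℝ) := by
    field_simp
    ring
  rw [this]
  exact div_pos (mul_pos (by linarith) (by linarith)) h5

theorem exists_moveDirection_add_smul_eq {m w : ℕ} (hm : 6 ≤ m) (hw : m + 1 ≤ w) :
    ∃ (μ : ℝ) (c : ℕ → ℝ), 0 ≤ c 5 ∧ 0 ≤ c m ∧ c (m + 1) = 0 ∧
      moveDirection m + μ • momentPoint w =
        ∑ i ∈ ({1, 2, 3, 4, 5, m, m + 1} : Finset ℕ), c i • momentPoint i := by
  set S : Finset ℕ := {1, 2, 3, 4, 5, m, m + 1} with hS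
  set L : ℕ → ℝ := fun i => (Lagrange.basis S (fun j : ℕ => (j : ℝ)) i).eval (w : ℝ) with hL
  have hm' : (6 : ℝ) ≤ m := by exact_mod_cast hm
  have hw' : (m : ℝ) + 1 ≤ w := by exact_mod_cast hw
  have hcard : S.card = 7 := by
    rw [hS]
    repeat rw [Finset.card_insert_of_notMem (by
      simp only [Finset.mem_insert, Finset.mem_singleton]; omega)]
    rw [Finset.card_singleton]
  have hsum := momentPoint_eq_sum S hcard w
  have heval : ∀ i, L i = ∏ j ∈ S.erase i, ((i : ℝ) - j)⁻¹ * ((w : ℝ) - j) := fun i => by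
    simp [hL, Lagrange.basis, Lagrange.basisDivisor, eval_prod]
  have hqm := quartic_pos (t := m) (by linarith)
  have hqm' := quartic_pos (t := m + 1) (by linarith)
  have hqw := quartic_pos (t := w) (by linarith)
  have hL5 : L 5 = (24 : ℝ)⁻¹ * quartic w * ((w - m) / (m - 5)) * ((w - (m + 1)) / (m - 4)) := by
    rw [heval, show S.erase 5 = {1, 2, 3, 4, m, m + 1} by
        ext x; simp only [hS, Finset.mem_erase, Finset.mem_insert, Finset.mem_singleton]; omega,
      prod_insert_four (by omega) (by omega), quartic]
    push_cast
    have h1 : (5 : ℝ) - m ≠ 0 := by linarith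
    have h2 : (5 : ℝ) - (m + 1) ≠ 0 := by linarith
    have h3 : (m : ℝ) - 5 ≠ 0 := by linarith
    have h4 : (m : ℝ) - 4 ≠ 0 := by linarith
    field_simp
    ring
  have hLm : L m = -(quartic w * (w - 5) * (w - (m + 1)) / (quartic m * (m - 5))) := by
    rw [heval, show S.erase m = {1, 2, 3, 4, 5, m + 1} by
        ext x; simp only [hS, Finset.mem_erase, Finset.mem_insert, Finset.mem_singleton]; omega,
      prod_insert_four (by omega) (by omega)]
    unfold quartic
    push_cast
    rw [show (m : ℝ) - (m + 1) = -1 by ring]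
    simp only [div_eq_mul_inv, mul_inv]
    ring
  have hLm' : L (m + 1) = quartic w * (w - 5) * (w - m) / (quartic (m + 1) * (m - 4)) := by
    rw [heval, show S.erase (m + 1) = {1, 2, 3, 4, 5, m} by
        ext x; simp only [hS, Finset.mem_erase, Finset.mem_insert, Finset.mem_singleton]; omega,
      prod_insert_four (by omega) (by omega)]
    unfold quartic
    push_cast
    rw [show (m : ℝ) + 1 - m = 1 by ring, show (m : ℝ) + 1 - 5 = m - 4 by ring]
    simp only [div_eq_mul_inv, mul_inv]
    ring
  have h5 : 0 < (w : ℝ) - 5 := by linarith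
  have h6 : 0 < (w : ℝ) - m := by linarith
  have h7 : 0 < (m : ℝ) - 5 := by linarith
  have h8 : 0 < (m : ℝ) - 4 := by linarith
  have h9 : 0 ≤ (w : ℝ) - (m + 1) := by linarith
  set μ : ℝ := (m - 4) / (quartic w * (w - 5) * (w - m)) with hμ
  refine ⟨μ, fun i => μ * L i + ((if i = m then moveCoeff m else 0) -
    (if i = m + 1 then (quartic (m + 1))⁻¹ else 0) -
    (if i = 1 then moveCoeff m - (quartic (m + 1))⁻¹ else 0)), ?_, ?_, ?_, ?_⟩
  · beta_reduce
    rw [if_neg (by omega), if_neg (by omega), if_neg (by omega), hL5, hμ]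
    simp only [sub_zero, add_zero]
    positivity
  · beta_reduce
    rw [if_pos rfl, if_neg (by omega), if_neg (by omega), hLm, hμ, moveCoeff]
    have : (m - 4) / (quartic w * (w - 5) * (w - m)) *
        -(quartic w * (w - 5) * (w - (m + 1)) / (quartic m * (m - 5))) +
        ((m - 4) / ((m - 5) * quartic m) - 0 - 0) =
        (m - 4 : ℝ) / ((m - 5) * quartic m * (w - m)) := by
      field_simp
      ring
    rw [this]
    positivity
  · beta_reduce
    rw [if_neg (by omega), if_pos rfl, if_neg (by omega), hLm', hμ]
    field_simp
    ring
  · change momentPoint w = ∑ i ∈ S, L i • momentPoint i at hsum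
    simp_rw [add_smul, Finset.sum_add_distrib, mul_smul, ← Finset.smul_sum]
    rw [← hsum, add_comm, moveDirection]
    congr 1
    simp_rw [sub_smul, Finset.sum_sub_distrib, ite_smul, zero_smul, Finset.sum_ite_eq']
    simp [hS, sub_smul]

theorem exists_simplexFacet_cyclicVertices_insert {N m : ℕ} (hm : 6 ≤ m) (hmN : m ≤ N)
    (hN : 7 ≤ N) :
    ∃ (V : Finset (Fin 7 → ℝ)) (w : Fin 6 → Fin 7 → ℝ) (h : Fin 6 → (Fin 7 → ℝ) →ₗ[ℝ] ℝ)
      (f : (Fin 7 → ℝ) →ₗ[ℝ] ℝ),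
      IsConfiguration (LinearMap.proj 0) V (N + 1) (N.choose 2 + m) ∧ IsSimplexFacet V w h f := by
  have hV := isConfiguration_cyclicVertices hN
  have hGcard : (({1, 2, 3, 4} : Finset ℕ).image momentPoint).card = 4 := by
    rw [Finset.card_image_of_injective _ momentPoint_injective]; rfl
  have hsub : ∀ S : Finset ℕ, (∀ j ∈ S, 1 ≤ j ∧ j ≤ N) →
      S.image momentPoint ⊆ cyclicVertices N := fun S hS x hx => by
    obtain ⟨j, hj, rfl⟩ := Finset.mem_image.1 hx
    exact momentPoint_mem_cyclicVertices.2 (hS j hj)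
  have hG : ({1, 2, 3, 4} : Finset ℕ).image momentPoint ⊆ cyclicVertices N :=
    hsub _ fun j hj => by simp at hj; omega
  have hmem : ∀ j : ℕ, ∀ S : Finset ℕ, momentPoint j ∈ S.image momentPoint ↔ j ∈ S :=
    fun j S => by simp [momentPoint_injective.eq_iff]
  have hconf := hV.eventually_insert (u := moveDirection m)
    (N := (Finset.Icc 1 m).image momentPoint) hG (by omega)
    (by simp [moveDirection, momentPoint]) (hsub _ fun j hj => by simp at hj; omega)
    ⟨momentPoint 1, (hmem _ _).2 (by simp; omega)⟩ ?_ ?_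
  rotate_left
  · intro y hy
    obtain ⟨j, hj, rfl⟩ := Finset.mem_image.1 hy
    rw [Finset.mem_Icc] at hj
    obtain ⟨k, hk, hkm, hjk⟩ : ∃ k, 5 ≤ k ∧ k + 1 ≤ m ∧ (j ≤ 4 ∨ j = k ∨ j = k + 1) := by
      rcases le_or_gt j 5 with h | h
      · exact ⟨5, by omega⟩
      · exact ⟨j - 1, by omega⟩
    have hjS : j ∈ ({1, 2, 3, 4, k, k + 1} : Finset ℕ) := by
      simp only [Finset.mem_insert, Finset.mem_singleton]; omega
    refine ⟨({1, 2, 3, 4, k, k + 1} : Finset ℕ).image momentPoint,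
      coeffFunctional (facetPolynomial k), basisFunctional {1, 2, 3, 4, k, k + 1} j, ?_, ?_,
      exposedBy_facetPolynomial N k, facetPolynomial_moveDirection_pos hk hkm, (hmem _ _).2 hjS,
      ?_, ?_⟩
    · exact Finset.image_subset_image fun i hi => by
        simp only [Finset.mem_insert, Finset.mem_singleton] at hi ⊢; omega
    · exact hsub _ fun i hi => by
        simp only [Finset.mem_insert, Finset.mem_singleton] at hi; omega
    · rw [basisFunctional_momentPoint (Finset.card_le_six.trans (by norm_num)) hjS hjS, if_pos rfl]
    · intro a ha haj
      obtain ⟨i, hi, rfl⟩ := Finset.mem_image.1 ha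
      rw [basisFunctional_momentPoint (Finset.card_le_six.trans (by norm_num)) hjS hi, if_neg]
      rintro rfl
      exact haj rfl
  · intro x hx hxN
    obtain ⟨j, hj, rfl⟩ := Finset.mem_image.1 hx
    rw [Finset.mem_Icc] at hj
    rw [hmem, Finset.mem_Icc] at hxN
    refine ⟨by rw [hmem]; simp; omega, ?_⟩
    obtain ⟨μ, c, hc5, hcm, hcm', hsum⟩ :=
      exists_moveDirection_add_smul_eq hm (by omega : m + 1 ≤ j)
    have hS : ∀ i ∈ ({1, 2, 3, 4, 5, m, m + 1} : Finset ℕ), i ≤ 4 ∨ i = 5 ∨ i = m ∨ i = m + 1 :=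
      fun i hi => by simp only [Finset.mem_insert, Finset.mem_singleton] at hi; omega
    refine ⟨μ, fun v => ∑ i ∈ ({1, 2, 3, 4, 5, m, m + 1} : Finset ℕ),
      if momentPoint i = v then c i else 0, ?_, ?_, ?_⟩
    · intro v hv hvG
      refine Finset.sum_nonneg fun i hi => ?_
      split_ifs with h
      · rw [← h, hmem] at hvG
        simp only [Finset.mem_insert, Finset.mem_singleton] at hvG hi
        rcases hi with rfl | rfl | rfl | rfl | rfl | rfl | rfl
        all_goals first | omega | assumption | exact hcm'.ge
      · exact le_rfl
    · refine Finset.sum_eq_zero fun i hi => ?_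
      split_ifs with h
      · have := momentPoint_injective h
        have h1 := hS i hi
        rw [show i = m + 1 by omega, hcm']
      · rfl
    · rw [hsum]
      simp_rw [Finset.sum_smul, ite_smul, zero_smul]
      rw [Finset.sum_comm]
      refine Finset.sum_congr rfl fun i hi => ?_
      rw [Finset.sum_ite_eq, if_pos]
      refine momentPoint_mem_cyclicVertices.2 ?_
      simp only [Finset.mem_insert, Finset.mem_singleton] at hi
      omega
  obtain ⟨f, hexp⟩ : IsFace (cyclicVertices N)
      (({2, 3, 4, 5, 6, 7} : Finset ℕ).image momentPoint) := by
    refine ⟨coeffFunctional (-((X - C 2) * (X - C 3) * (X - C 4) * (X - C 5) * (X - C 6) *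
      (X - C 7))), ?_⟩
    refine exposedBy_cyclicVertices (by compute_degree) ?_ ?_
    · intro j hj
      simp only [Finset.mem_insert, Finset.mem_singleton] at hj
      rcases hj with rfl | rfl | rfl | rfl | rfl | rfl <;> simp
    · intro j hj1 hj
      simp only [Finset.mem_insert, Finset.mem_singleton, not_or] at hj
      rcases hj1.eq_or_lt with rfl | h
      · norm_num
      · have h8 : (8 : ℝ) ≤ j := by exact_mod_cast (by omega : 8 ≤ j)
        have h2 : 0 < (j : ℝ) - 2 := by linarith
        have h3 : 0 < (j : ℝ) - 3 := by linarith
        have h4 : 0 < (j : ℝ) - 4 := by linarith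
        have h5 : 0 < (j : ℝ) - 5 := by linarith
        have h6 : 0 < (j : ℝ) - 6 := by linarith
        have h7 : 0 < (j : ℝ) - 7 := by linarith
        simp only [eval_neg, eval_mul, eval_sub, eval_X, eval_C, neg_lt_zero]
        positivity
  have hneg := hexp.eventually_neg hG (fun h => by
    have := (hmem 1 _).1 (h ((hmem 1 _).2 (by simp)))
    simp at this) (moveDirection m)
  obtain ⟨ε, hconf, hneg⟩ := (hconf.and hneg).exists
  have hcardN : ((Finset.Icc 1 m).image momentPoint).card = m := by
    rw [Finset.card_image_of_injective _ momentPoint_injective]; simp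
  rw [hcardN] at hconf
  have hexp' := hexp.insert_of_neg hneg
  have hmem6 : ∀ i : Fin 6, (i : ℕ) + 2 ∈ ({2, 3, 4, 5, 6, 7} : Finset ℕ) := by decide
  refine ⟨_, fun i => momentPoint (i + 2), fun i => basisFunctional {2, 3, 4, 5, 6, 7} (i + 2),
    f, hconf, ?_, ?_, ?_, ?_, ?_⟩
  · exact fun i => Finset.mem_insert_of_mem (momentPoint_mem_cyclicVertices.2 (by omega))
  · intro i j
    rw [basisFunctional_momentPoint (by decide) (hmem6 i) (hmem6 j)]
    simp [Fin.ext_iff]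
  · exact fun i => hexp'.1 _ ((hmem _ _).2 (hmem6 i))
  · intro v hv hne
    refine hexp'.2 v hv fun hvS => ?_
    obtain ⟨j, hj, rfl⟩ := Finset.mem_image.1 hvS
    simp only [Finset.mem_insert, Finset.mem_singleton] at hj
    exact hne ⟨j - 2, by omega⟩ (congrArg _ (by simp; omega))
  · intro h0
    rw [h0] at hneg
    simp at hneg

end MomentCurve

section Certificates

open Matrix

variable {n m r e : ℕ}

/-- Every point of `p` other than `p i` and `p j` is cut off by one of the functionals `F t` that
vanish at `p i` and `p j`. -/
def IsSeparated (p : Fin n → Fin 7 → ℤ) (F : Fin m → Fin 7 → ℤ) (i j : Fin n) : Prop :=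
  ∀ k, k ≠ i → k ≠ j → ∃ t, F t ⬝ᵥ p i = 0 ∧ F t ⬝ᵥ p j = 0 ∧ F t ⬝ᵥ p k < 0

/-- The coefficients `γ` are nonnegative away from `i` and `j`, and not all zero there. -/
def IsCrossing (γ : Fin n → ℤ) (i j : Fin n) : Prop :=
  (∀ k, k ≠ i → k ≠ j → 0 ≤ γ k) ∧ ∃ k, k ≠ i ∧ k ≠ j ∧ 0 < γ k

instance (p : Fin n → Fin 7 → ℤ) (F : Fin m → Fin 7 → ℤ) (i j : Fin n) :
    Decidable (IsSeparated p F i j) := by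
  unfold IsSeparated; infer_instance

instance (γ : Fin n → ℤ) (i j : Fin n) : Decidable (IsCrossing γ i j) := by
  unfold IsCrossing; infer_instance

/-- An integer vector as a real vector. -/
def realPoint (x : Fin 7 → ℤ) : Fin 7 → ℝ := fun c => (x c : ℝ)

/-- The linear functional with integer coefficients `a`. -/
noncomputable def intFunctional (a : Fin 7 → ℤ) : (Fin 7 → ℝ) →ₗ[ℝ] ℝ :=
  ∑ c, (a c : ℝ) • LinearMap.proj c

theorem intFunctional_realPoint (a x : Fin 7 → ℤ) :
    intFunctional a (realPoint x) = ((a ⬝ᵥ x : ℤ) : ℝ) := by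
  simp [intFunctional, realPoint, dotProduct]

open Classical in
/-- The point configuration with coordinates `p`. -/
noncomputable def realPoints (p : Fin n → Fin 7 → ℤ) : Finset (Fin 7 → ℝ) :=
  Finset.univ.image fun i => realPoint (p i)

theorem mem_realPoints {p : Fin n → Fin 7 → ℤ} {x : Fin 7 → ℝ} :
    x ∈ realPoints p ↔ ∃ i, realPoint (p i) = x := by
  simp [realPoints]

theorem realPoint_mem_realPoints (p : Fin n → Fin 7 → ℤ) (i : Fin n) :
    realPoint (p i) ∈ realPoints p := mem_realPoints.2 ⟨i, rfl⟩

variable {p : Fin n → Fin 7 → ℤ} {F : Fin m → Fin 7 → ℤ} {R : Fin r → Fin n → ℤ} {i j : Fin n}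

theorem IsSeparated.isFace (hF : ∀ t i, F t ⬝ᵥ p i ≤ 0) (h : IsSeparated p F i j) :
    IsFace (realPoints p) {realPoint (p i), realPoint (p j)} := by
  have hf : ∀ k, (∑ t with F t ⬝ᵥ p i = 0 ∧ F t ⬝ᵥ p j = 0, intFunctional (F t)) (realPoint (p k)) =
      ((∑ t with F t ⬝ᵥ p i = 0 ∧ F t ⬝ᵥ p j = 0, F t ⬝ᵥ p k : ℤ) : ℝ) := fun k => by
    simp only [LinearMap.sum_apply, intFunctional_realPoint, Int.cast_sum]
  refine ⟨∑ t with F t ⬝ᵥ p i = 0 ∧ F t ⬝ᵥ p j = 0, intFunctional (F t), fun a ha => ?_,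
    fun w hw hwA => ?_⟩
  · rcases Finset.mem_insert.1 ha with rfl | ha
    · rw [hf, Finset.sum_eq_zero fun t ht => (Finset.mem_filter.1 ht).2.1, Int.cast_zero]
    · rw [Finset.mem_singleton.1 ha, hf,
        Finset.sum_eq_zero fun t ht => (Finset.mem_filter.1 ht).2.2, Int.cast_zero]
  · obtain ⟨k, rfl⟩ := mem_realPoints.1 hw
    rw [hf]
    have hki : k ≠ i := fun hk => hwA (by simp [hk])
    have hkj : k ≠ j := fun hk => hwA (by simp [hk])
    obtain ⟨t, hti, htj, htk⟩ := h k hki hkj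
    have hneg : ∑ t with F t ⬝ᵥ p i = 0 ∧ F t ⬝ᵥ p j = 0, F t ⬝ᵥ p k < 0 :=
      Finset.sum_neg' (fun t _ => hF t k)
        ⟨t, Finset.mem_filter.2 ⟨Finset.mem_univ t, hti, htj⟩, htk⟩
    exact_mod_cast hneg

theorem injective_realPoint_of_isSeparated (hS : ∀ i, IsSeparated p F i i) :
    Function.Injective fun i => realPoint (p i) := by
  intro i k hik
  by_contra hne
  obtain ⟨t, hti, -, htk⟩ := hS i k (Ne.symm hne) (Ne.symm hne)
  have h1 := intFunctional_realPoint (F t) (p i)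
  simp only at hik
  rw [hik, intFunctional_realPoint, hti] at h1
  exact htk.ne (by exact_mod_cast h1)

theorem IsCrossing.not_isFace {γ : Fin n → ℤ} (hS : ∀ i, IsSeparated p F i i)
    (hγ : ∑ k, γ k • p k = 0) (h : IsCrossing γ i j) :
    ¬ IsFace (realPoints p) {realPoint (p i), realPoint (p j)} := by
  rintro ⟨f, hf0, hf⟩
  have hinj := injective_realPoint_of_isSeparated hS
  have hsum : ∑ k, (γ k : ℝ) * f (realPoint (p k)) = 0 := by
    have : ∑ k, (γ k : ℝ) • realPoint (p k) = 0 := by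
      ext c
      have := congrFun hγ c
      simp only [Finset.sum_apply, Pi.smul_apply, smul_eq_mul, Pi.zero_apply] at this ⊢
      unfold realPoint
      exact_mod_cast this
    simpa using congrArg f this
  have hneg : ∀ k, k ≠ i → k ≠ j → f (realPoint (p k)) < 0 := fun k hki hkj =>
    hf _ (realPoint_mem_realPoints p k) fun hk => by
      rcases Finset.mem_insert.1 hk with hk | hk
      · exact hki (hinj hk)
      · exact hkj (hinj (Finset.mem_singleton.1 hk))
  obtain ⟨hnn, k, hki, hkj, hk⟩ := h
  refine hsum.not_lt (Finset.sum_neg' (fun l _ => ?_)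
    ⟨k, Finset.mem_univ k, mul_neg_of_pos_of_neg (by exact_mod_cast hk) (hneg k hki hkj)⟩)
  by_cases hli : l = i
  · rw [hli, hf0 _ (by simp), mul_zero]
  by_cases hlj : l = j
  · rw [hlj, hf0 _ (by simp), mul_zero]
  exact mul_nonpos_of_nonneg_of_nonpos (by exact_mod_cast hnn l hli hlj) (hneg l hli hlj).le

theorem card_edgeSet_realPoints (hF : ∀ t i, F t ⬝ᵥ p i ≤ 0) (hS : ∀ i, IsSeparated p F i i)
    (hR : ∀ s, ∑ k, R s k • p k = 0)
    (hp : ∀ i j, i < j → IsSeparated p F i j ∨ ∃ s, IsCrossing (R s) i j ∨ IsCrossing (-R s) i j) :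
    (edgeSet (realPoints p)).card =
      ((Finset.univ : Finset (Fin n × Fin n)).filter fun q =>
        q.1 < q.2 ∧ IsSeparated p F q.1 q.2).card := by
  classical
  have hinj := injective_realPoint_of_isSeparated hS
  symm
  refine Finset.card_bij (fun q _ => {realPoint (p q.1), realPoint (p q.2)}) ?_ ?_ ?_
  · rintro ⟨i, j⟩ hq
    obtain ⟨-, hij, hsep⟩ := Finset.mem_filter.1 hq
    refine mem_edgeSet.2 ⟨?_, Finset.card_pair fun h => hij.ne (hinj h), hsep.isFace hF⟩
    simp [Finset.insert_subset_iff, realPoint_mem_realPoints]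
  · rintro ⟨i, j⟩ hq ⟨k, l⟩ hq' h
    have hij := (Finset.mem_filter.1 hq).2.1
    have hkl := (Finset.mem_filter.1 hq').2.1
    have h2 : ({i, j} : Finset (Fin n)) = {k, l} := by
      refine Finset.image_injective hinj ?_
      simpa [Finset.image_insert] using h
    have hi : i ∈ ({k, l} : Finset (Fin n)) := by simp [← h2]
    have hj : j ∈ ({k, l} : Finset (Fin n)) := by simp [← h2]
    simp only [Finset.mem_insert, Finset.mem_singleton] at hi hj
    grind
  · intro A hA
    obtain ⟨hAV, hcard, hface⟩ := mem_edgeSet.1 hA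
    obtain ⟨a, b, hab, rfl⟩ := Finset.card_eq_two.1 hcard
    obtain ⟨i, rfl⟩ := mem_realPoints.1 (hAV (Finset.mem_insert_self a _))
    obtain ⟨j, rfl⟩ := mem_realPoints.1
      (hAV (Finset.mem_insert_of_mem (Finset.mem_singleton_self b)))
    have key : ∀ i j, i < j → IsFace (realPoints p) {realPoint (p i), realPoint (p j)} →
        IsSeparated p F i j := fun i j hij hface => by
      rcases hp i j hij with h | ⟨s, h | h⟩
      · exact h
      · exact absurd hface (h.not_isFace hS (hR s))
      · exact absurd hface (h.not_isFace hS (by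
          simp only [Pi.neg_apply, neg_smul, Finset.sum_neg_distrib, hR s, neg_zero]))
    rcases lt_trichotomy i j with hij | rfl | hij
    · exact ⟨(i, j), by simpa [hij] using key i j hij hface, rfl⟩
    · exact absurd rfl hab
    · rw [Finset.pair_comm] at hface ⊢
      exact ⟨(j, i), by simpa [hij] using key j i hij hface, rfl⟩

/-- Some configuration in `Fin 7 → ℝ` with `n` points and `e` edges has a simplex facet. -/
def HasSimplexFacet (n e : ℕ) : Prop :=
  ∃ (V : Finset (Fin 7 → ℝ)) (u : Fin 6 → Fin 7 → ℝ) (h : Fin 6 → (Fin 7 → ℝ) →ₗ[ℝ] ℝ)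
    (f : (Fin 7 → ℝ) →ₗ[ℝ] ℝ), IsConfiguration (LinearMap.proj 0) V n e ∧ IsSimplexFacet V u h f

/-- Some configuration in `Fin 7 → ℝ` with `n` points and `e` edges has a simple vertex and a
simplex facet. -/
def HasSimpleVertexSimplexFacet (n e : ℕ) : Prop :=
  ∃ (V : Finset (Fin 7 → ℝ)) (v : Fin 7 → ℝ) (w : Fin 6 → Fin 7 → ℝ)
    (κ : Fin 6 → (Fin 7 → ℝ) →ₗ[ℝ] ℝ) (u : Fin 6 → Fin 7 → ℝ) (h : Fin 6 → (Fin 7 → ℝ) →ₗ[ℝ] ℝ)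
    (f : (Fin 7 → ℝ) →ₗ[ℝ] ℝ), IsConfiguration (LinearMap.proj 0) V n e ∧
      IsSimpleVertex V v w κ ∧ IsSimplexFacet V u h f

/-- A configuration in normal position: the first point is a simple vertex whose edges point along
the coordinate axes, and the points with vanishing last coordinate form a simplex facet. -/
theorem HasSimpleVertexSimplexFacet.of_certificate (hn : 7 ≤ n) (p : Fin n → Fin 7 → ℤ)
    (F : Fin m → Fin 7 → ℤ) (R : Fin r → Fin n → ℤ)
    (h0 : ∀ i, p i 0 = 1) (hnn : ∀ i c, 0 ≤ p i c)
    (haxis : ∀ i c : Fin 7, c ≠ 0 → c ≠ i → p (i.castLE hn) c = 0)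
    (hpos : ∀ i : Fin 7, 0 < p (i.castLE hn) i)
    (hlast : ∀ i, p i 6 = 0 → (i : ℕ) < 6)
    (hF : ∀ t i, F t ⬝ᵥ p i ≤ 0) (hS : ∀ i, IsSeparated p F i i)
    (hedge : ∀ i : Fin 7, IsSeparated p F ((0 : Fin 7).castLE hn) (i.castLE hn))
    (hR : ∀ s, ∑ k, R s k • p k = 0)
    (hp : ∀ i j, i < j → IsSeparated p F i j ∨ ∃ s, IsCrossing (R s) i j ∨ IsCrossing (-R s) i j)
    (he : ((Finset.univ : Finset (Fin n × Fin n)).filter fun q =>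
        q.1 < q.2 ∧ IsSeparated p F q.1 q.2).card = e) :
    HasSimpleVertexSimplexFacet n e := by
  set y : Fin 7 → Fin 7 → ℝ := fun i => realPoint (p (i.castLE hn)) with hy
  have hyV : ∀ i, y i ∈ realPoints p := fun i => realPoint_mem_realPoints p _
  have hy0 : ∀ i, y i 0 = 1 := fun i => by simp [hy, realPoint, h0]
  have hyc : ∀ i c, c ≠ 0 → c ≠ i → y i c = 0 := fun i c hc hci => by
    simp [hy, realPoint, haxis i c hc hci]
  have hyi : ∀ i, 0 < y i i := fun i => by
    simp only [hy, realPoint]; exact_mod_cast hpos i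
  set δ : Fin 7 → (Fin 7 → ℝ) →ₗ[ℝ] ℝ := fun i =>
    if i = 0 then LinearMap.proj 0 - ∑ c with c ≠ 0, (y c c)⁻¹ • LinearMap.proj c
    else (y i i)⁻¹ • LinearMap.proj i with hδ
  have hδ0 : ∀ x, δ 0 x = x 0 - ∑ c with c ≠ 0, (y c c)⁻¹ * x c := fun x => by simp [hδ]
  have hδi : ∀ i, i ≠ 0 → ∀ x, δ i x = (y i i)⁻¹ * x i := fun i hi x => by simp [hδ, hi]
  have hdual : ∀ i j, δ i (y j) = if i = j then 1 else 0 := by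
    have hne : ∀ i, i ≠ 0 → ∀ j, (y i i)⁻¹ * y j i = if i = j then 1 else 0 := fun i hi j => by
      split_ifs with hij
      · rw [← hij, inv_mul_cancel₀ (hyi i).ne']
      · rw [hyc j i hi hij, mul_zero]
    intro i j
    by_cases hi : i = 0
    · rw [hi, hδ0, hy0, Finset.sum_congr rfl fun c hc => hne c (Finset.mem_filter.1 hc).2 j,
        Finset.sum_ite_eq']
      by_cases hj : j = 0 <;> simp [hj, Ne.symm]
    · rw [hδi i hi, hne i hi]
  have hspan : ∀ x : Fin 7 → ℝ, x = ∑ i, δ i x • y i := by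
    intro x
    ext c
    simp only [Finset.sum_apply, Pi.smul_apply, smul_eq_mul]
    by_cases hc : c = 0
    · simp only [hc, hy0, mul_one]
      rw [← Finset.add_sum_erase _ _ (Finset.mem_univ 0), hδ0, ← Finset.filter_ne',
        Finset.sum_congr rfl fun i hi => hδi i (Finset.mem_filter.1 hi).2 x, sub_add_cancel]
    · rw [Finset.sum_eq_single c, hδi c hc, mul_right_comm, inv_mul_cancel₀ (hyi c).ne', one_mul]
      · exact fun i _ hi => by rw [hyc i c hc (Ne.symm hi), mul_zero]
      · simp
  refine ⟨realPoints p, y 0, fun i => y i.succ, fun i => δ i.succ, fun i => y i.castSucc,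
    fun i => δ i.castSucc, -LinearMap.proj 6, ⟨?_, ?_, ?_, ?_, ?_⟩, ⟨hyV 0, fun i => hyV _, ?_, ?_,
    ?_, fun i => (hedge _).isFace hF⟩, ⟨fun i => hyV _, ?_, ?_, ?_, ?_⟩⟩
  · intro v hv
    obtain ⟨i, rfl⟩ := mem_realPoints.1 hv
    simp [realPoint, h0]
  · intro v hv
    obtain ⟨i, rfl⟩ := mem_realPoints.1 hv
    simpa using (hS i).isFace hF
  · rw [realPoints, Finset.card_image_of_injective _ (injective_realPoint_of_isSeparated hS),
      Finset.card_fin]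
  · rw [card_edgeSet_realPoints hF hS hR hp, he]
  · refine Submodule.eq_top_iff'.2 fun x => ?_
    rw [hspan x]
    exact Submodule.sum_mem _ fun i _ => Submodule.smul_mem _ _ (Submodule.subset_span (hyV i))
  · exact fun i => by rw [hdual, if_neg (Fin.succ_ne_zero i)]
  · exact fun i j => by simp [hdual]
  · intro v hv i
    obtain ⟨j, rfl⟩ := mem_realPoints.1 hv
    rw [hδi _ (Fin.succ_ne_zero i)]
    exact mul_nonneg (inv_nonneg.2 (hyi _).le) (by simpa [realPoint] using hnn j _)
  · exact fun i j => by simp [hdual]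
  · intro i
    rw [LinearMap.neg_apply, LinearMap.proj_apply,
      hyc _ 6 (by decide) (Fin.castSucc_lt_last i).ne', neg_zero]
  · intro v hv hne
    obtain ⟨i, rfl⟩ := mem_realPoints.1 hv
    rw [LinearMap.neg_apply, LinearMap.proj_apply, neg_lt_zero]
    refine lt_of_le_of_ne (by simpa [realPoint] using hnn i 6) fun h6 => ?_
    have hi := hlast i (by simpa [realPoint] using h6.symm)
    exact hne ⟨i, hi⟩ rfl
  · intro hz
    have := congrArg (fun g : (Fin 7 → ℝ) →ₗ[ℝ] ℝ => g (y 6)) hz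
    simp [(hyi 6).ne'] at this

end Certificates

section BasePolytopes

/-- Realized by the threefold pyramid over a square pyramid stacked over a triangle. -/
theorem hasSimpleVertexSimplexFacet_9_32 : HasSimpleVertexSimplexFacet 9 32 :=
  .of_certificate (by decide)
    ![![1, 0, 0, 0, 0, 0, 0], ![1, 1, 0, 0, 0, 0, 0], ![1, 0, 4, 0, 0, 0, 0],
      ![1, 0, 0, 1, 0, 0, 0], ![1, 0, 0, 0, 1, 0, 0], ![1, 0, 0, 0, 0, 1, 0],
      ![1, 0, 0, 0, 0, 0, 2], ![1, 1, 0, 0, 0, 0, 2], ![1, 1, 1, 0, 0, 0, 1]]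
    ![![0, 0, 0, 0, 0, 0, -1], ![0, 0, 0, 0, 0, -1, 0], ![0, 0, 0, 0, -1, 0, 0],
      ![0, 0, 0, -1, 0, 0, 0], ![0, 0, -1, 0, 0, 0, 0], ![0, -1, 0, 0, 0, 0, 0],
      ![-4, 4, 1, 4, 4, 4, -1], ![-1, 1, 0, 1, 1, 1, 0], ![-4, 0, 1, 4, 4, 4, 2],
      ![-4, 2, 1, 4, 4, 4, 1]]
    ![![-1, 1, 0, 0, 0, 0, 1, -1, 0], ![-3, 4, 1, 0, 0, 0, 2, 0, -4],
      ![1, 0, 1, 0, 0, 0, -2, 4, -4]]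
    (by decide) (by decide) (by decide) (by decide) (by decide) (by decide +kernel)
    (by decide +kernel) (by decide +kernel) (by decide +kernel) (by decide +kernel)
    (by decide +kernel)

/-- Realized by the threefold pyramid over a square pyramid truncated at a simple vertex. -/
theorem hasSimpleVertexSimplexFacet_10_35 : HasSimpleVertexSimplexFacet 10 35 :=
  .of_certificate (by decide)
    ![![1, 0, 0, 0, 0, 0, 0], ![1, 2, 0, 0, 0, 0, 0], ![1, 0, 2, 0, 0, 0, 0],
      ![1, 0, 0, 1, 0, 0, 0], ![1, 0, 0, 0, 1, 0, 0], ![1, 0, 0, 0, 0, 1, 0],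
      ![1, 0, 0, 0, 0, 0, 1], ![1, 0, 1, 0, 0, 0, 1], ![1, 1, 0, 0, 0, 0, 2],
      ![1, 2, 0, 0, 0, 0, 2]]
    ![![0, 0, 0, 0, 0, 0, -1], ![0, 0, 0, 0, 0, -1, 0], ![0, 0, 0, 0, -1, 0, 0],
      ![0, 0, 0, -1, 0, 0, 0], ![0, 0, -1, 0, 0, 0, 0], ![0, -1, 0, 0, 0, 0, 0],
      ![-2, 1, 1, 2, 2, 2, 0], ![-2, 0, 1, 2, 2, 2, 1], ![-1, -1, 0, 1, 1, 1, 1]]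
    ![![-1, 0, 1, 0, 0, 0, 2, -2, 0, 0], ![-3, 1, 0, 0, 0, 0, 4, 0, -2, 0],
      ![-2, 1, 0, 0, 0, 0, 2, 0, 0, -1], ![1, -1, 2, 0, 0, 0, 0, -4, 2, 0],
      ![1, -1, 0, 0, 0, 0, 0, 0, -2, 2], ![0, 0, -1, 0, 0, 0, 0, 2, -2, 1],
      ![1, 0, 0, 0, 0, 0, -2, 0, 2, -1]]
    (by decide) (by decide) (by decide) (by decide) (by decide) (by decide +kernel)
    (by decide +kernel) (by decide +kernel) (by decide +kernel) (by decide +kernel)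
    (by decide +kernel)

/-- Realized by the twofold pyramid over a truncated twofold pyramid over a square. -/
theorem hasSimpleVertexSimplexFacet_11_38 : HasSimpleVertexSimplexFacet 11 38 :=
  .of_certificate (by decide)
    ![![1, 0, 0, 0, 0, 0, 0], ![1, 2, 0, 0, 0, 0, 0], ![1, 0, 2, 0, 0, 0, 0],
      ![1, 0, 0, 2, 0, 0, 0], ![1, 0, 0, 0, 1, 0, 0], ![1, 0, 0, 0, 0, 1, 0],
      ![1, 0, 0, 0, 0, 0, 1], ![1, 0, 0, 1, 0, 0, 1], ![1, 0, 1, 0, 0, 0, 1],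
      ![1, 1, 0, 0, 0, 0, 2], ![1, 2, 0, 0, 0, 0, 2]]
    ![![0, 0, 0, 0, 0, 0, -1], ![0, 0, 0, 0, 0, -1, 0], ![0, 0, 0, 0, -1, 0, 0],
      ![0, 0, 0, -1, 0, 0, 0], ![0, 0, -1, 0, 0, 0, 0], ![0, -1, 0, 0, 0, 0, 0],
      ![-2, 1, 1, 1, 2, 2, 0], ![-2, 0, 1, 1, 2, 2, 1], ![-1, -1, 0, 0, 1, 1, 1]]
    ![![-1, 0, 0, 1, 0, 0, 2, -2, 0, 0, 0], ![-1, 0, 1, 0, 0, 0, 2, 0, -2, 0, 0],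
      ![-3, 1, 0, 0, 0, 0, 4, 0, 0, -2, 0], ![-2, 1, 0, 0, 0, 0, 2, 0, 0, 0, -1],
      ![1, -1, 0, 2, 0, 0, 0, -4, 0, 2, 0], ![1, -1, 2, 0, 0, 0, 0, 0, -4, 2, 0],
      ![1, -1, 0, 0, 0, 0, 0, 0, 0, -2, 2], ![0, 0, -1, 1, 0, 0, 0, -2, 2, 0, 0],
      ![0, 0, -1, 0, 0, 0, 0, 0, 2, -2, 1], ![0, 0, 0, -1, 0, 0, 0, 2, 0, -2, 1],
      ![1, 0, 0, 0, 0, 0, -2, 0, 0, 2, -1]]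
    (by decide) (by decide) (by decide) (by decide) (by decide) (by decide +kernel)
    (by decide +kernel) (by decide +kernel) (by decide +kernel) (by decide +kernel)
    (by decide +kernel)

/-- Realized by the pyramid over a truncated twofold pyramid over a triangular bipyramid. -/
theorem hasSimpleVertexSimplexFacet_12_41 : HasSimpleVertexSimplexFacet 12 41 :=
  .of_certificate (by decide)
    ![![1, 0, 0, 0, 0, 0, 0], ![1, 1, 0, 0, 0, 0, 0], ![1, 0, 1, 0, 0, 0, 0],
      ![1, 0, 0, 1, 0, 0, 0], ![1, 0, 0, 0, 1, 0, 0], ![1, 0, 0, 0, 0, 1, 0],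
      ![1, 0, 0, 0, 0, 0, 1], ![1, 0, 0, 0, 2, 0, 1], ![1, 0, 0, 2, 0, 0, 1],
      ![1, 0, 2, 0, 0, 0, 1], ![1, 2, 0, 0, 0, 0, 1], ![1, 2, 2, 0, 0, 0, 5]]
    ![![0, 0, 0, 0, 0, 0, -1], ![0, 0, 0, 0, 0, -1, 0], ![0, 0, 0, 0, -1, 0, 0],
      ![0, 0, 0, -1, 0, 0, 0], ![0, 0, -1, 0, 0, 0, 0], ![0, -1, 0, 0, 0, 0, 0],
      ![-1, 1, 1, 1, 1, 1, -1], ![-1, -2, 0, 0, 0, 1, 1], ![-1, 0, -2, 0, 0, 1, 1],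
      ![-3, 2, 2, 2, 2, 3, -1]]
    ![![-2, 0, 0, 0, 2, 0, 1, -1, 0, 0, 0, 0], ![-2, 0, 0, 2, 0, 0, 1, 0, -1, 0, 0, 0],
      ![-2, 0, 2, 0, 0, 0, 1, 0, 0, -1, 0, 0], ![-2, 2, 0, 0, 0, 0, 1, 0, 0, 0, -1, 0],
      ![-8, 2, 2, 0, 0, 0, 5, 0, 0, 0, 0, -1], ![0, -2, 0, 0, 2, 0, 0, -1, 0, 0, 1, 0],
      ![0, -2, 0, 2, 0, 0, 0, 0, -1, 0, 1, 0], ![0, -2, 2, 0, 0, 0, 0, 0, 0, -1, 1, 0],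
      ![2, -8, 2, 0, 0, 0, 0, 0, 0, 0, 5, -1], ![0, 0, -2, 0, 2, 0, 0, -1, 0, 1, 0, 0],
      ![0, 0, -2, 2, 0, 0, 0, 0, -1, 1, 0, 0], ![2, 2, -8, 0, 0, 0, 0, 0, 0, 5, 0, -1],
      ![0, 0, 0, -2, 2, 0, 0, -1, 1, 0, 0, 0], ![2, 2, 2, -10, 0, 0, 0, 0, 5, 0, 0, -1],
      ![2, 2, 2, 0, -10, 0, 0, 5, 0, 0, 0, -1]]
    (by decide) (by decide) (by decide) (by decide) (by decide) (by decide +kernel)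
    (by decide +kernel) (by decide +kernel) (by decide +kernel) (by decide +kernel)
    (by decide +kernel)

/-- Realized by the pyramid over a truncated twofold pyramid over a triangular prism. -/
theorem hasSimpleVertexSimplexFacet_13_44 : HasSimpleVertexSimplexFacet 13 44 :=
  .of_certificate (by decide)
    ![![1, 0, 0, 0, 0, 0, 0], ![1, 2, 0, 0, 0, 0, 0], ![1, 0, 2, 0, 0, 0, 0],
      ![1, 0, 0, 2, 0, 0, 0], ![1, 0, 0, 0, 2, 0, 0], ![1, 0, 0, 0, 0, 1, 0],
      ![1, 0, 0, 0, 0, 0, 1], ![1, 0, 0, 0, 1, 0, 1], ![1, 0, 0, 1, 0, 0, 1],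
      ![1, 0, 1, 0, 0, 0, 2], ![1, 0, 2, 0, 0, 0, 2], ![1, 1, 0, 0, 0, 0, 2],
      ![1, 2, 0, 0, 0, 0, 2]]
    ![![0, 0, 0, 0, 0, 0, -1], ![0, 0, 0, 0, 0, -1, 0], ![0, 0, 0, 0, -1, 0, 0],
      ![0, 0, 0, -1, 0, 0, 0], ![0, 0, -1, 0, 0, 0, 0], ![0, -1, 0, 0, 0, 0, 0],
      ![-2, 1, 1, 1, 1, 2, 0], ![-2, 0, 0, 1, 1, 2, 1], ![-1, -1, -1, 0, 0, 1, 1]]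
    ![![-1, 0, 0, 0, 1, 0, 2, -2, 0, 0, 0, 0, 0], ![-1, 0, 0, 1, 0, 0, 2, 0, -2, 0, 0, 0, 0],
      ![-3, 0, 1, 0, 0, 0, 4, 0, 0, -2, 0, 0, 0], ![-2, 0, 1, 0, 0, 0, 2, 0, 0, 0, -1, 0, 0],
      ![-3, 1, 0, 0, 0, 0, 4, 0, 0, 0, 0, -2, 0], ![-2, 1, 0, 0, 0, 0, 2, 0, 0, 0, 0, 0, -1],
      ![1, -1, 0, 0, 2, 0, 0, -4, 0, 0, 0, 2, 0], ![1, -1, 0, 2, 0, 0, 0, 0, -4, 0, 0, 2, 0],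
      ![0, -1, 1, 0, 0, 0, 0, 0, 0, -2, 0, 2, 0], ![0, -1, 1, 0, 0, 0, 0, 0, 0, 0, -1, 0, 1],
      ![1, -1, 0, 0, 0, 0, 0, 0, 0, 0, 0, -2, 2], ![1, 0, -1, 0, 2, 0, 0, -4, 0, 2, 0, 0, 0],
      ![1, 0, -1, 2, 0, 0, 0, 0, -4, 2, 0, 0, 0], ![1, 0, -1, 0, 0, 0, 0, 0, 0, -2, 2, 0, 0],
      ![0, 0, 0, -1, 1, 0, 0, -2, 2, 0, 0, 0, 0], ![0, 0, 0, -1, 0, 0, 0, 0, 2, -2, 1, 0, 0],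
      ![0, 0, 0, -1, 0, 0, 0, 0, 2, 0, 0, -2, 1], ![0, 0, 0, 0, -1, 0, 0, 2, 0, -2, 1, 0, 0],
      ![0, 0, 0, 0, -1, 0, 0, 2, 0, 0, 0, -2, 1], ![1, 0, 0, 0, 0, 0, -2, 0, 0, 2, -1, 0, 0],
      ![1, 0, 0, 0, 0, 0, -2, 0, 0, 0, 0, 2, -1], ![0, 0, 0, 0, 0, 0, 0, 0, 0, -2, 1, 2, -1]]
    (by decide) (by decide) (by decide) (by decide) (by decide) (by decide +kernel)
    (by decide +kernel) (by decide +kernel) (by decide +kernel) (by decide +kernel)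
    (by decide +kernel)

/-- Realized by the threefold pyramid over a stacked triangular bipyramid. -/
theorem hasSimpleVertexSimplexFacet_9_33 : HasSimpleVertexSimplexFacet 9 33 :=
  .of_certificate (by decide)
    ![![1, 0, 0, 0, 0, 0, 0], ![1, 1, 0, 0, 0, 0, 0], ![1, 0, 1, 0, 0, 0, 0],
      ![1, 0, 0, 1, 0, 0, 0], ![1, 0, 0, 0, 1, 0, 0], ![1, 0, 0, 0, 0, 1, 0],
      ![1, 0, 0, 0, 0, 0, 1], ![1, 1, 1, 0, 0, 0, 3], ![1, 2, 2, 0, 0, 0, 1]]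
    ![![0, 0, 0, 0, 0, 0, -1], ![0, 0, 0, 0, 0, -1, 0], ![0, 0, 0, 0, -1, 0, 0],
      ![0, 0, 0, -1, 0, 0, 0], ![0, 0, -1, 0, 0, 0, 0], ![0, -1, 0, 0, 0, 0, 0],
      ![-1, 1, 1, 1, 1, 1, -3], ![-1, 1, -3, 1, 1, 1, 1], ![-5, 5, -3, 5, 5, 5, 1],
      ![-1, -3, 1, 1, 1, 1, 1], ![-5, -3, 5, 5, 5, 5, 1]]
    ![![-4, 0, 0, 0, 0, 0, 5, -2, 1], ![-4, 2, 2, 0, 0, 0, 1, 0, -1]]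
    (by decide) (by decide) (by decide) (by decide) (by decide) (by decide +kernel)
    (by decide +kernel) (by decide +kernel) (by decide +kernel) (by decide +kernel)
    (by decide +kernel)

/-- Realized by the threefold pyramid over a truncated triangular bipyramid. -/
theorem hasSimpleVertexSimplexFacet_10_36 : HasSimpleVertexSimplexFacet 10 36 :=
  .of_certificate (by decide)
    ![![1, 0, 0, 0, 0, 0, 0], ![1, 1, 0, 0, 0, 0, 0], ![1, 0, 1, 0, 0, 0, 0],
      ![1, 0, 0, 1, 0, 0, 0], ![1, 0, 0, 0, 1, 0, 0], ![1, 0, 0, 0, 0, 1, 0],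
      ![1, 0, 0, 0, 0, 0, 1], ![1, 0, 2, 0, 0, 0, 1], ![1, 2, 0, 0, 0, 0, 1],
      ![1, 2, 2, 0, 0, 0, 5]]
    ![![0, 0, 0, 0, 0, 0, -1], ![0, 0, 0, 0, 0, -1, 0], ![0, 0, 0, 0, -1, 0, 0],
      ![0, 0, 0, -1, 0, 0, 0], ![0, 0, -1, 0, 0, 0, 0], ![0, -1, 0, 0, 0, 0, 0],
      ![-1, 1, 1, 1, 1, 1, -1], ![-1, -2, 0, 1, 1, 1, 1], ![-1, 0, -2, 1, 1, 1, 1],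
      ![-3, 2, 2, 3, 3, 3, -1]]
    ![![-2, 0, 2, 0, 0, 0, 1, -1, 0, 0], ![-2, 2, 0, 0, 0, 0, 1, 0, -1, 0],
      ![-8, 2, 2, 0, 0, 0, 5, 0, 0, -1], ![0, -2, 2, 0, 0, 0, 0, -1, 1, 0],
      ![2, -8, 2, 0, 0, 0, 0, 0, 5, -1], ![2, 2, -8, 0, 0, 0, 0, 5, 0, -1]]
    (by decide) (by decide) (by decide) (by decide) (by decide) (by decide +kernel)
    (by decide +kernel) (by decide +kernel) (by decide +kernel) (by decide +kernel)
    (by decide +kernel)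

/-- Realized by the threefold pyramid over a truncated triangular prism. -/
theorem hasSimpleVertexSimplexFacet_11_39 : HasSimpleVertexSimplexFacet 11 39 :=
  .of_certificate (by decide)
    ![![1, 0, 0, 0, 0, 0, 0], ![1, 2, 0, 0, 0, 0, 0], ![1, 0, 2, 0, 0, 0, 0],
      ![1, 0, 0, 1, 0, 0, 0], ![1, 0, 0, 0, 1, 0, 0], ![1, 0, 0, 0, 0, 1, 0],
      ![1, 0, 0, 0, 0, 0, 1], ![1, 0, 1, 0, 0, 0, 2], ![1, 0, 2, 0, 0, 0, 2],
      ![1, 1, 0, 0, 0, 0, 2], ![1, 2, 0, 0, 0, 0, 2]]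
    ![![0, 0, 0, 0, 0, 0, -1], ![0, 0, 0, 0, 0, -1, 0], ![0, 0, 0, 0, -1, 0, 0],
      ![0, 0, 0, -1, 0, 0, 0], ![0, 0, -1, 0, 0, 0, 0], ![0, -1, 0, 0, 0, 0, 0],
      ![-2, 1, 1, 2, 2, 2, 0], ![-1, -1, -1, 1, 1, 1, 1], ![-2, 0, 0, 2, 2, 2, 1]]
    ![![-3, 0, 1, 0, 0, 0, 4, -2, 0, 0, 0], ![-2, 0, 1, 0, 0, 0, 2, 0, -1, 0, 0],
      ![-3, 1, 0, 0, 0, 0, 4, 0, 0, -2, 0], ![-2, 1, 0, 0, 0, 0, 2, 0, 0, 0, -1],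
      ![0, -1, 1, 0, 0, 0, 0, -2, 0, 2, 0], ![0, -1, 1, 0, 0, 0, 0, 0, -1, 0, 1],
      ![1, -1, 0, 0, 0, 0, 0, 0, 0, -2, 2], ![1, 0, -1, 0, 0, 0, 0, -2, 2, 0, 0],
      ![1, 0, 0, 0, 0, 0, -2, 2, -1, 0, 0], ![1, 0, 0, 0, 0, 0, -2, 0, 0, 2, -1],
      ![0, 0, 0, 0, 0, 0, 0, -2, 1, 2, -1]]
    (by decide) (by decide) (by decide) (by decide) (by decide) (by decide +kernel)
    (by decide +kernel) (by decide +kernel) (by decide +kernel) (by decide +kernel)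
    (by decide +kernel)

/-- Realized by the twofold pyramid over a truncated pyramid over a triangular prism. -/
theorem hasSimpleVertexSimplexFacet_12_42 : HasSimpleVertexSimplexFacet 12 42 :=
  .of_certificate (by decide)
    ![![1, 0, 0, 0, 0, 0, 0], ![1, 2, 0, 0, 0, 0, 0], ![1, 0, 2, 0, 0, 0, 0],
      ![1, 0, 0, 2, 0, 0, 0], ![1, 0, 0, 0, 1, 0, 0], ![1, 0, 0, 0, 0, 1, 0],
      ![1, 0, 0, 0, 0, 0, 1], ![1, 0, 0, 1, 0, 0, 1], ![1, 0, 1, 0, 0, 0, 2],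
      ![1, 0, 2, 0, 0, 0, 2], ![1, 1, 0, 0, 0, 0, 2], ![1, 2, 0, 0, 0, 0, 2]]
    ![![0, 0, 0, 0, 0, 0, -1], ![0, 0, 0, 0, 0, -1, 0], ![0, 0, 0, 0, -1, 0, 0],
      ![0, 0, 0, -1, 0, 0, 0], ![0, 0, -1, 0, 0, 0, 0], ![0, -1, 0, 0, 0, 0, 0],
      ![-2, 1, 1, 1, 2, 2, 0], ![-2, 0, 0, 1, 2, 2, 1], ![-1, -1, -1, 0, 1, 1, 1]]
    ![![-1, 0, 0, 1, 0, 0, 2, -2, 0, 0, 0, 0], ![-3, 0, 1, 0, 0, 0, 4, 0, -2, 0, 0, 0],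
      ![-2, 0, 1, 0, 0, 0, 2, 0, 0, -1, 0, 0], ![-3, 1, 0, 0, 0, 0, 4, 0, 0, 0, -2, 0],
      ![-2, 1, 0, 0, 0, 0, 2, 0, 0, 0, 0, -1], ![1, -1, 0, 2, 0, 0, 0, -4, 0, 0, 2, 0],
      ![0, -1, 1, 0, 0, 0, 0, 0, -2, 0, 2, 0], ![0, -1, 1, 0, 0, 0, 0, 0, 0, -1, 0, 1],
      ![1, -1, 0, 0, 0, 0, 0, 0, 0, 0, -2, 2], ![1, 0, -1, 2, 0, 0, 0, -4, 2, 0, 0, 0],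
      ![1, 0, -1, 0, 0, 0, 0, 0, -2, 2, 0, 0], ![0, 0, 0, -1, 0, 0, 0, 2, -2, 1, 0, 0],
      ![0, 0, 0, -1, 0, 0, 0, 2, 0, 0, -2, 1], ![1, 0, 0, 0, 0, 0, -2, 0, 2, -1, 0, 0],
      ![1, 0, 0, 0, 0, 0, -2, 0, 0, 0, 2, -1], ![0, 0, 0, 0, 0, 0, 0, 0, -2, 1, 2, -1]]
    (by decide) (by decide) (by decide) (by decide) (by decide) (by decide +kernel)
    (by decide +kernel) (by decide +kernel) (by decide +kernel) (by decide +kernel)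
    (by decide +kernel)

/-- Realized by the pyramid over a truncated twofold pyramid over a 3-polytope with 6 vertices and
10 edges. -/
theorem hasSimpleVertexSimplexFacet_13_45 : HasSimpleVertexSimplexFacet 13 45 :=
  .of_certificate (by decide)
    ![![1, 0, 0, 0, 0, 0, 0], ![1, 1, 0, 0, 0, 0, 0], ![1, 0, 1, 0, 0, 0, 0],
      ![1, 0, 0, 1, 0, 0, 0], ![1, 0, 0, 0, 1, 0, 0], ![1, 0, 0, 0, 0, 1, 0],
      ![1, 0, 0, 0, 0, 0, 1], ![1, 0, 0, 0, 2, 0, 1], ![1, 0, 0, 2, 0, 0, 1],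
      ![1, 0, 1, 0, 0, 0, 2], ![1, 0, 2, 0, 0, 0, 1], ![1, 2, 0, 0, 0, 0, 1],
      ![1, 2, 0, 0, 0, 0, 3]]
    ![![0, 0, 0, 0, 0, 0, -1], ![0, 0, 0, 0, 0, -1, 0], ![0, 0, 0, 0, -1, 0, 0],
      ![0, 0, 0, -1, 0, 0, 0], ![0, 0, -1, 0, 0, 0, 0], ![0, -1, 0, 0, 0, 0, 0],
      ![-1, 1, 1, 1, 1, 1, -1], ![-1, -1, -1, 0, 0, 1, 1], ![-3, 0, 1, 1, 1, 3, 1],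
      ![-2, 1, 1, 1, 1, 2, 0]]
    ![![-2, 0, 0, 0, 2, 0, 1, -1, 0, 0, 0, 0, 0], ![-2, 0, 0, 2, 0, 0, 1, 0, -1, 0, 0, 0, 0],
      ![-2, 0, 1, 0, 0, 0, 2, 0, 0, -1, 0, 0, 0], ![-2, 0, 2, 0, 0, 0, 1, 0, 0, 0, -1, 0, 0],
      ![-2, 2, 0, 0, 0, 0, 1, 0, 0, 0, 0, -1, 0], ![-4, 2, 0, 0, 0, 0, 3, 0, 0, 0, 0, 0, -1],
      ![0, -2, 0, 0, 2, 0, 0, -1, 0, 0, 0, 1, 0], ![0, -2, 0, 2, 0, 0, 0, 0, -1, 0, 0, 1, 0],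
      ![2, -4, 1, 0, 0, 0, 0, 0, 0, -1, 0, 2, 0], ![0, -2, 2, 0, 0, 0, 0, 0, 0, 0, -1, 1, 0],
      ![2, -4, 0, 0, 0, 0, 0, 0, 0, 0, 0, 3, -1], ![0, 0, -2, 0, 2, 0, 0, -1, 0, 0, 1, 0, 0],
      ![0, 0, -2, 2, 0, 0, 0, 0, -1, 0, 1, 0, 0], ![2, 0, -3, 0, 0, 0, 0, 0, 0, -1, 2, 0, 0],
      ![0, 0, -1, 0, 0, 0, 0, 0, 0, 1, 0, 1, -1], ![0, 0, 0, -2, 2, 0, 0, -1, 1, 0, 0, 0, 0],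
      ![2, 0, 1, -4, 0, 0, 0, 0, 2, -1, 0, 0, 0], ![2, 2, 0, -6, 0, 0, 0, 0, 3, 0, 0, 0, -1],
      ![2, 0, 1, 0, -4, 0, 0, 2, 0, -1, 0, 0, 0], ![2, 2, 0, 0, -6, 0, 0, 3, 0, 0, 0, 0, -1],
      ![2, 0, 0, 0, 0, 0, -3, 0, 0, 2, -1, 0, 0], ![2, 0, 0, 0, 0, 0, -2, 0, 0, 0, 0, -1, 1]]
    (by decide) (by decide) (by decide) (by decide) (by decide) (by decide +kernel)
    (by decide +kernel) (by decide +kernel) (by decide +kernel) (by decide +kernel)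
    (by decide +kernel)

/-- Realized by the free sum of a triangle and a 4-simplex, stacked over a facet. -/
theorem hasSimpleVertexSimplexFacet_9_34 : HasSimpleVertexSimplexFacet 9 34 :=
  .of_certificate (by decide)
    ![![1, 0, 0, 0, 0, 0, 0], ![1, 3, 0, 0, 0, 0, 0], ![1, 0, 3, 0, 0, 0, 0],
      ![1, 0, 0, 3, 0, 0, 0], ![1, 0, 0, 0, 3, 0, 0], ![1, 0, 0, 0, 0, 3, 0],
      ![1, 0, 0, 0, 0, 0, 3], ![1, 0, 0, 3, 3, 3, 3], ![1, 5, 5, 2, 2, 2, 2]]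
    ![![0, 0, 0, 0, 0, 0, -1], ![0, 0, 0, 0, 0, -1, 0], ![0, 0, 0, 0, -1, 0, 0],
      ![0, 0, 0, -1, 0, 0, 0], ![0, 0, -1, 0, 0, 0, 0], ![0, -1, 0, 0, 0, 0, 0],
      ![-6, 2, 2, 2, 2, 2, -13], ![-6, 2, 2, 2, 2, -13, 2], ![-6, 2, 2, 2, -13, 2, 2],
      ![-6, 2, 2, -13, 2, 2, 2], ![-15, 5, -4, 5, 5, 5, -10], ![-15, 5, -4, 5, 5, -10, 5],
      ![-15, 5, -4, 5, -10, 5, 5], ![-15, 5, -4, -10, 5, 5, 5], ![-15, -4, 5, 5, 5, 5, -10],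
      ![-15, -4, 5, 5, 5, -10, 5], ![-15, -4, 5, 5, -10, 5, 5], ![-15, -4, 5, -10, 5, 5, 5]]
    ![![-3, 0, 0, 1, 1, 1, 1, -1, 0], ![-9, 5, 5, 0, 0, 0, 0, 2, -3]]
    (by decide) (by decide) (by decide) (by decide) (by decide) (by decide +kernel)
    (by decide +kernel) (by decide +kernel) (by decide +kernel) (by decide +kernel)
    (by decide +kernel)

/-- Realized by the threefold pyramid over a stacked 3-polytope with 6 vertices and 10 edges. -/
theorem hasSimpleVertexSimplexFacet_10_37 : HasSimpleVertexSimplexFacet 10 37 :=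
  .of_certificate (by decide)
    ![![1, 0, 0, 0, 0, 0, 0], ![1, 3, 0, 0, 0, 0, 0], ![1, 0, 3, 0, 0, 0, 0],
      ![1, 0, 0, 1, 0, 0, 0], ![1, 0, 0, 0, 1, 0, 0], ![1, 0, 0, 0, 0, 1, 0],
      ![1, 0, 0, 0, 0, 0, 2], ![1, 3, 3, 0, 0, 0, 2], ![1, 4, 1, 0, 0, 0, 3],
      ![1, 6, 0, 0, 0, 0, 2]]
    ![![0, 0, 0, 0, 0, 0, -1], ![0, 0, 0, 0, 0, -1, 0], ![0, 0, 0, 0, -1, 0, 0],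
      ![0, 0, 0, -1, 0, 0, 0], ![0, 0, -1, 0, 0, 0, 0], ![0, -1, 0, 0, 0, 0, 0],
      ![-6, 2, 2, 6, 6, 6, -3], ![-6, -2, 2, 6, 6, 6, 3], ![-6, -1, 1, 6, 6, 6, 3],
      ![-2, 0, -1, 2, 2, 2, 1], ![-8, 1, 1, 8, 8, 8, 1]]
    ![![-2, 1, 1, 0, 0, 0, 1, -1, 0, 0], ![-13, 8, 2, 0, 0, 0, 9, 0, -6, 0],
      ![-2, 2, 0, 0, 0, 0, 1, 0, 0, -1], ![0, -1, 1, 0, 0, 0, 0, -1, 0, 1],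
      ![5, -10, 2, 0, 0, 0, 0, 0, -6, 9], ![3, 0, -6, 0, 0, 0, 1, 8, -6, 0]]
    (by decide) (by decide) (by decide) (by decide) (by decide) (by decide +kernel)
    (by decide +kernel) (by decide +kernel) (by decide +kernel) (by decide +kernel)
    (by decide +kernel)

/-- Realized by the threefold pyramid over a truncated 3-polytope with 6 vertices and 10 edges. -/
theorem hasSimpleVertexSimplexFacet_11_40 : HasSimpleVertexSimplexFacet 11 40 :=
  .of_certificate (by decide)
    ![![1, 0, 0, 0, 0, 0, 0], ![1, 1, 0, 0, 0, 0, 0], ![1, 0, 1, 0, 0, 0, 0],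
      ![1, 0, 0, 1, 0, 0, 0], ![1, 0, 0, 0, 1, 0, 0], ![1, 0, 0, 0, 0, 1, 0],
      ![1, 0, 0, 0, 0, 0, 1], ![1, 0, 1, 0, 0, 0, 2], ![1, 0, 2, 0, 0, 0, 1],
      ![1, 2, 0, 0, 0, 0, 1], ![1, 2, 0, 0, 0, 0, 3]]
    ![![0, 0, 0, 0, 0, 0, -1], ![0, 0, 0, 0, 0, -1, 0], ![0, 0, 0, 0, -1, 0, 0],
      ![0, 0, 0, -1, 0, 0, 0], ![0, 0, -1, 0, 0, 0, 0], ![0, -1, 0, 0, 0, 0, 0],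
      ![-1, 1, 1, 1, 1, 1, -1], ![-1, -1, -1, 1, 1, 1, 1], ![-3, 0, 1, 3, 3, 3, 1],
      ![-2, 1, 1, 2, 2, 2, 0]]
    ![![-2, 0, 1, 0, 0, 0, 2, -1, 0, 0, 0], ![-2, 0, 2, 0, 0, 0, 1, 0, -1, 0, 0],
      ![-2, 2, 0, 0, 0, 0, 1, 0, 0, -1, 0], ![-4, 2, 0, 0, 0, 0, 3, 0, 0, 0, -1],
      ![2, -4, 1, 0, 0, 0, 0, -1, 0, 2, 0], ![0, -2, 2, 0, 0, 0, 0, 0, -1, 1, 0],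
      ![2, -4, 0, 0, 0, 0, 0, 0, 0, 3, -1], ![2, 0, -3, 0, 0, 0, 0, -1, 2, 0, 0],
      ![0, 0, -1, 0, 0, 0, 0, 1, 0, 1, -1], ![2, 0, 0, 0, 0, 0, -3, 2, -1, 0, 0],
      ![2, 0, 0, 0, 0, 0, -2, 0, 0, -1, 1]]
    (by decide) (by decide) (by decide) (by decide) (by decide) (by decide +kernel)
    (by decide +kernel) (by decide +kernel) (by decide +kernel) (by decide +kernel)
    (by decide +kernel)

/-- Realized by the twofold pyramid over a truncated pyramid over a 3-polytope with 6 vertices and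
10 edges. -/
theorem hasSimpleVertexSimplexFacet_12_43 : HasSimpleVertexSimplexFacet 12 43 :=
  .of_certificate (by decide)
    ![![1, 0, 0, 0, 0, 0, 0], ![1, 1, 0, 0, 0, 0, 0], ![1, 0, 1, 0, 0, 0, 0],
      ![1, 0, 0, 1, 0, 0, 0], ![1, 0, 0, 0, 1, 0, 0], ![1, 0, 0, 0, 0, 1, 0],
      ![1, 0, 0, 0, 0, 0, 1], ![1, 0, 0, 2, 0, 0, 1], ![1, 0, 1, 0, 0, 0, 2],
      ![1, 0, 2, 0, 0, 0, 1], ![1, 2, 0, 0, 0, 0, 1], ![1, 2, 0, 0, 0, 0, 3]]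
    ![![0, 0, 0, 0, 0, 0, -1], ![0, 0, 0, 0, 0, -1, 0], ![0, 0, 0, 0, -1, 0, 0],
      ![0, 0, 0, -1, 0, 0, 0], ![0, 0, -1, 0, 0, 0, 0], ![0, -1, 0, 0, 0, 0, 0],
      ![-1, 1, 1, 1, 1, 1, -1], ![-1, -1, -1, 0, 1, 1, 1], ![-3, 0, 1, 1, 3, 3, 1],
      ![-2, 1, 1, 1, 2, 2, 0]]
    ![![-2, 0, 0, 2, 0, 0, 1, -1, 0, 0, 0, 0], ![-2, 0, 1, 0, 0, 0, 2, 0, -1, 0, 0, 0],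
      ![-2, 0, 2, 0, 0, 0, 1, 0, 0, -1, 0, 0], ![-2, 2, 0, 0, 0, 0, 1, 0, 0, 0, -1, 0],
      ![-4, 2, 0, 0, 0, 0, 3, 0, 0, 0, 0, -1], ![0, -2, 0, 2, 0, 0, 0, -1, 0, 0, 1, 0],
      ![2, -4, 1, 0, 0, 0, 0, 0, -1, 0, 2, 0], ![0, -2, 2, 0, 0, 0, 0, 0, 0, -1, 1, 0],
      ![2, -4, 0, 0, 0, 0, 0, 0, 0, 0, 3, -1], ![0, 0, -2, 2, 0, 0, 0, -1, 0, 1, 0, 0],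
      ![2, 0, -3, 0, 0, 0, 0, 0, -1, 2, 0, 0], ![0, 0, -1, 0, 0, 0, 0, 0, 1, 0, 1, -1],
      ![2, 0, 1, -4, 0, 0, 0, 2, -1, 0, 0, 0], ![2, 2, 0, -6, 0, 0, 0, 3, 0, 0, 0, -1],
      ![2, 0, 0, 0, 0, 0, -3, 0, 2, -1, 0, 0], ![2, 0, 0, 0, 0, 0, -2, 0, 0, 0, -1, 1]]
    (by decide) (by decide) (by decide) (by decide) (by decide) (by decide +kernel)
    (by decide +kernel) (by decide +kernel) (by decide +kernel) (by decide +kernel)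
    (by decide +kernel)

/-- Realized by the pyramid over a truncated twofold pyramid over a stacked square pyramid. -/
theorem hasSimpleVertexSimplexFacet_13_46 : HasSimpleVertexSimplexFacet 13 46 :=
  .of_certificate (by decide)
    ![![1, 0, 0, 0, 0, 0, 0], ![1, 2, 0, 0, 0, 0, 0], ![1, 0, 4, 0, 0, 0, 0],
      ![1, 0, 0, 2, 0, 0, 0], ![1, 0, 0, 0, 2, 0, 0], ![1, 0, 0, 0, 0, 1, 0],
      ![1, 0, 0, 0, 0, 0, 1], ![1, 0, 0, 0, 1, 0, 1], ![1, 0, 0, 1, 0, 0, 1],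
      ![1, 0, 2, 0, 0, 0, 1], ![1, 1, 0, 0, 0, 0, 2], ![1, 2, 0, 0, 0, 0, 2],
      ![1, 2, 1, 0, 0, 0, 1]]
    ![![0, 0, 0, 0, 0, 0, -1], ![0, 0, 0, 0, 0, -1, 0], ![0, 0, 0, 0, -1, 0, 0],
      ![0, 0, 0, -1, 0, 0, 0], ![0, 0, -1, 0, 0, 0, 0], ![0, -1, 0, 0, 0, 0, 0],
      ![-4, 2, 1, 2, 2, 4, -1], ![-2, 1, 0, 1, 1, 2, 0], ![-4, 0, 1, 2, 2, 4, 2],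
      ![-4, 1, 1, 2, 2, 4, 1], ![-1, -1, 0, 0, 0, 1, 1]]
    ![![-1, 0, 0, 0, 1, 0, 2, -2, 0, 0, 0, 0, 0], ![-1, 0, 0, 1, 0, 0, 2, 0, -2, 0, 0, 0, 0],
      ![-1, 0, 1, 0, 0, 0, 2, 0, 0, -2, 0, 0, 0], ![-3, 1, 0, 0, 0, 0, 4, 0, 0, 0, -2, 0, 0],
      ![-2, 1, 0, 0, 0, 0, 2, 0, 0, 0, 0, -1, 0], ![-5, 4, 1, 0, 0, 0, 4, 0, 0, 0, 0, 0, -4],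
      ![1, -1, 0, 0, 2, 0, 0, -4, 0, 0, 2, 0, 0], ![1, -1, 0, 2, 0, 0, 0, 0, -4, 0, 2, 0, 0],
      ![1, -1, 2, 0, 0, 0, 0, 0, 0, -4, 2, 0, 0], ![1, -1, 0, 0, 0, 0, 0, 0, 0, 0, -2, 2, 0],
      ![0, 0, -1, 0, 1, 0, 0, -2, 0, 2, 0, 0, 0], ![0, 0, -1, 1, 0, 0, 0, 0, -2, 2, 0, 0, 0],
      ![0, 0, -1, 0, 0, 0, 0, 0, 0, 2, -2, 1, 0], ![0, 0, 0, -1, 1, 0, 0, -2, 2, 0, 0, 0, 0],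
      ![0, 0, 0, -1, 0, 0, 0, 0, 2, 0, -2, 1, 0], ![0, 0, 0, 0, -1, 0, 0, 2, 0, 0, -2, 1, 0],
      ![1, 0, 0, 0, 0, 0, -2, 0, 0, 0, 2, -1, 0], ![7, 0, 1, 0, 0, 0, -12, 0, 0, 0, 8, 0, -4],
      ![1, 0, 1, 0, 6, 0, 0, -12, 0, 0, 8, 0, -4], ![1, 0, 1, 6, 0, 0, 0, 0, -12, 0, 8, 0, -4],
      ![1, 0, 7, 0, 0, 0, 0, 0, 0, -12, 8, 0, -4], ![1, 0, 1, 0, 0, 0, 0, 0, 0, 0, -4, 6, -4]]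
    (by decide) (by decide) (by decide) (by decide) (by decide) (by decide +kernel)
    (by decide +kernel) (by decide +kernel) (by decide +kernel) (by decide +kernel)
    (by decide +kernel)

end BasePolytopes

section Realization

variable {n e : ℕ}

theorem HasSimpleVertexSimplexFacet.hasSimplexFacet (h : HasSimpleVertexSimplexFacet n e) :
    HasSimplexFacet n e := by
  obtain ⟨V, v, w, κ, u, h, f, hV, -, hF⟩ := h
  exact ⟨V, u, h, f, hV, hF⟩

theorem HasSimpleVertexSimplexFacet.truncate (h : HasSimpleVertexSimplexFacet n e) :
    HasSimpleVertexSimplexFacet (n + 5) (e + 15) := by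
  classical
  obtain ⟨V, v, w, κ, -, -, -, hV, hS, -⟩ := h
  obtain ⟨V', v', w', κ', u, h, f, hV', hS', hF'⟩ := hV.exists_truncate hS (by simp)
  exact ⟨V', v', w', κ', u, h, f, hV', by convert hS', hF'⟩

theorem HasSimplexFacet.stack (h : HasSimplexFacet n e) : HasSimplexFacet (n + 1) (e + 6) := by
  obtain ⟨V, u, h, f, hV, hF⟩ := h
  obtain ⟨V', u', h', f', hV', hF'⟩ := hV.exists_stack hF (by simp)
  exact ⟨V', u', h', f', hV', hF'⟩

theorem hasSimpleVertexSimplexFacet_of_small {x : ℕ} (hx : 5 ≤ x) (hx' : x ≤ 7) :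
    ∀ n, 9 ≤ n → HasSimpleVertexSimplexFacet n (3 * n + x)
  | n, hn => by
    by_cases h : n ≤ 13
    · interval_cases x <;> interval_cases n
      exacts [hasSimpleVertexSimplexFacet_9_32, hasSimpleVertexSimplexFacet_10_35,
        hasSimpleVertexSimplexFacet_11_38, hasSimpleVertexSimplexFacet_12_41,
        hasSimpleVertexSimplexFacet_13_44, hasSimpleVertexSimplexFacet_9_33,
        hasSimpleVertexSimplexFacet_10_36, hasSimpleVertexSimplexFacet_11_39,
        hasSimpleVertexSimplexFacet_12_42, hasSimpleVertexSimplexFacet_13_45,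
        hasSimpleVertexSimplexFacet_9_34, hasSimpleVertexSimplexFacet_10_37,
        hasSimpleVertexSimplexFacet_11_40, hasSimpleVertexSimplexFacet_12_43,
        hasSimpleVertexSimplexFacet_13_46]
    · obtain ⟨k, rfl⟩ : ∃ k, n = k + 5 := ⟨n - 5, by omega⟩
      have := (hasSimpleVertexSimplexFacet_of_small hx hx' k (by omega)).truncate
      rwa [show 3 * k + x + 15 = 3 * (k + 5) + x by ring] at this

theorem hasSimplexFacet_of_choose_add {k : ℕ} (hk : 6 ≤ k) (hkn : k ≤ n) (hn : 7 ≤ n) :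
    HasSimplexFacet (n + 1) (n.choose 2 + k) := by
  obtain ⟨V, u, h, f, hV, hF⟩ := exists_simplexFacet_cyclicVertices_insert hk hkn hn
  exact ⟨V, u, h, f, hV, hF⟩

theorem hasSimplexFacet_of_le (n : ℕ) :
    ∀ e, 3 * n + 4 < e → 2 * e ≤ n * (n - 1) → HasSimplexFacet n e := by
  induction n with
  | zero => intro e he he'; omega
  | succ n ih =>
    intro e he he'
    rw [Nat.add_sub_cancel] at he'
    have hn : 8 ≤ n := by
      by_contra h
      interval_cases n <;> omega
    have hchoose : 2 * n.choose 2 = n * (n - 1) := by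
      rw [Nat.choose_two_right, Nat.mul_div_cancel' (Nat.even_mul_pred_self n).two_dvd]
    have hsucc : (n + 1) * n = n * (n - 1) + 2 * n := by
      obtain ⟨k, rfl⟩ : ∃ k, n = k + 1 := ⟨n - 1, by omega⟩
      rw [Nat.add_sub_cancel]; ring
    obtain ⟨x, rfl⟩ : ∃ x, e = 3 * (n + 1) + x := ⟨e - 3 * (n + 1), by omega⟩
    by_cases hx : x ≤ 7
    · exact (hasSimpleVertexSimplexFacet_of_small (by omega) hx _ (by omega)).hasSimplexFacet
    by_cases htop : n.choose 2 + 6 ≤ 3 * (n + 1) + x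
    · obtain ⟨k, hk⟩ := Nat.exists_eq_add_of_le htop
      rw [hk, add_assoc]
      exact hasSimplexFacet_of_choose_add (by omega) (by omega) (by omega)
    · obtain ⟨y, rfl⟩ : ∃ y, x = y + 3 := ⟨x - 3, by omega⟩
      have := (ih (3 * n + y) (by omega) (by omega)).stack
      rwa [show 3 * n + y + 6 = 3 * (n + 1) + (y + 3) by ring] at this

theorem HasSimplexFacet.exists_isDPolytope (h : HasSimplexFacet n e) :
    ∃ P : Set (Fin 7 → ℝ), IsDPolytope 6 P ∧ f₀ P = n ∧ f₁ P = e := by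
  obtain ⟨V, u, _, _, hV, hF⟩ := h
  refine ⟨convexHull ℝ V, ⟨⟨V, rfl⟩, ?_⟩, ?_, ?_⟩
  · exact Nat.succ_injective (adim_convexHull _ hV.height hV.span_eq_top ⟨u 0, hF.mem 0⟩)
  · rw [f₀_convexHull hV.vertex, hV.card_vertices]
  · rw [f₁_convexHull _ hV.height hV.vertex, hV.card_edges]

end Realization

/-- The `(f₀, f₁)` pairs of 6-polytopes with excess degree `> 8` are exactly those
with `3·f₀ + 4 < f₁ ≤ f₀·(f₀-1)/2`. -/
theorem stmt15 :
    {v : ℕ × ℕ | ∃ (n : ℕ) (P : Set (Fin n → ℝ)), IsDPolytope 6 P ∧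
        f₀ P = v.1 ∧ f₁ P = v.2 ∧ 8 < 2 * (f₁ P : ℤ) - 6 * (f₀ P : ℤ)} =
      {v : ℕ × ℕ | 3 * v.1 + 4 < v.2 ∧ 2 * v.2 ≤ v.1 * (v.1 - 1)} := by
  ext ⟨a, b⟩
  constructor
  · rintro ⟨n, P, ⟨hP, -⟩, rfl, rfl, h⟩
    exact ⟨by simp only; omega, two_mul_f₁_le hP⟩
  · rintro ⟨h, h'⟩
    obtain ⟨P, hP, h0, h1⟩ := (hasSimplexFacet_of_le a b h h').exists_isDPolytope
    simp only at h h'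
    exact ⟨7, P, hP, h0, h1, by omega⟩
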